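/- arXiv:2404.02369 — 3 statements merged into one kernel-verified Lean document; each statement's English description precedes it below -/
import Mathlib

section
/- The number of ordered 3-tuples of points in [m]^3 that lie on a common plane through the origin (i.e., the 4 points including the origin are coplanar) is O(m^6 log m). -/
namespace Copl

/-- sup norm of an integer vector -/
def nm (v : Fin 3 → ℤ) : ℕ := Finset.univ.sup (fun i => (v i).natAbs)

/-- dot product -/
def dt (u v : Fin 3 → ℤ) : ℤ := u 0 * v 0 + u 1 * v 1 + u 2 * v 2

/-- cross product -/
def cr (u v : Fin 3 → ℤ) : Fin 3 → ℤ :=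
  ![u 1 * v 2 - u 2 * v 1, u 2 * v 0 - u 0 * v 2, u 0 * v 1 - u 1 * v 0]

/-- the box -/
noncomputable def B (m : ℕ) : Finset (Fin 3 → ℤ) := Fintype.piFinset fun _ => Finset.Ico (0:ℤ) m

lemma mem_B {m : ℕ} {v : Fin 3 → ℤ} : v ∈ B m ↔ ∀ i, 0 ≤ v i ∧ v i < m := by
  simp [B]

lemma card_B (m : ℕ) : (B m).card = m ^ 3 := by
  simp [B]

lemma abs_le_nm (v : Fin 3 → ℤ) (i : Fin 3) : |v i| ≤ nm v := by
  rw [Int.abs_eq_natAbs]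
  exact_mod_cast Finset.le_sup (f := fun i => (v i).natAbs) (Finset.mem_univ i)

lemma exists_nm (v : Fin 3 → ℤ) : ∃ i, |v i| = nm v := by
  obtain ⟨i, -, hi⟩ := Finset.exists_mem_eq_sup Finset.univ Finset.univ_nonempty
    (fun i => (v i).natAbs)
  refine ⟨i, ?_⟩
  rw [Int.abs_eq_natAbs, nm, hi]

lemma nm_le {v : Fin 3 → ℤ} {r : ℕ} (h : ∀ i, |v i| ≤ r) : nm v ≤ r := by
  obtain ⟨i, hi⟩ := exists_nm v
  have := h i
  omega

lemma nm_pos {v : Fin 3 → ℤ} (h : v ≠ 0) : 0 < nm v := by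
  by_contra h0
  apply h
  ext i
  have := abs_le_nm v i
  have h1 : nm v = 0 := by omega
  rw [h1] at this
  simpa using this

lemma cr_eq_zero_iff {u v : Fin 3 → ℤ} : cr u v = 0 ↔ ∀ i j, u i * v j = u j * v i := by
  constructor
  · intro h
    have h0 := congrFun h 0
    have h1 := congrFun h 1
    have h2 := congrFun h 2
    simp [cr] at h0 h1 h2
    intro i j
    fin_cases i <;> fin_cases j <;> simp <;> linarith
  · intro h
    ext i
    fin_cases i <;> simp [cr]
    · linarith [h 1 2]
    · linarith [h 2 0]
    · linarith [h 0 1]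

lemma nm_cr_le {u v : Fin 3 → ℤ} {s m : ℕ} (hu : ∀ i, |u i| ≤ s) (hv : ∀ i, |v i| ≤ m) :
    ∀ i, |cr u v i| ≤ 2 * s * m := by
  have key : ∀ i j k l, |u i * v j - u k * v l| ≤ 2 * s * m := by
    intro i j k l
    have h1 : |u i * v j| ≤ s * m := by
      rw [abs_mul]; exact mul_le_mul (hu i) (hv j) (abs_nonneg _) (by positivity)
    have h2 : |u k * v l| ≤ s * m := by
      rw [abs_mul]; exact mul_le_mul (hu k) (hv l) (abs_nonneg _) (by positivity)
    have := abs_sub (u i * v j) (u k * v l)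
    linarith
  intro i
  fin_cases i <;> simp [cr] <;> apply key

/-- Being primitive -/
def Prim (n : Fin 3 → ℤ) : Prop := ∃ x, dt x n = 1

lemma exists_prim {w : Fin 3 → ℤ} (hw : w ≠ 0) :
    ∃ (g : ℤ) (n : Fin 3 → ℤ), g ≠ 0 ∧ (∀ i, w i = g * n i) ∧ Prim n := by
  obtain ⟨a, ha⟩ := Int.gcd_dvd_left (w 0) (w 1)
  obtain ⟨b, hb⟩ := Int.gcd_dvd_right (w 0) (w 1)
  have e1 := Int.gcd_eq_gcd_ab (w 0) (w 1)
  set d : ℤ := (Int.gcd (w 0) (w 1) : ℤ) with hd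
  obtain ⟨c, hc⟩ := Int.gcd_dvd_left d (w 2)
  obtain ⟨e, he⟩ := Int.gcd_dvd_right d (w 2)
  have e2 := Int.gcd_eq_gcd_ab d (w 2)
  set g : ℤ := (Int.gcd d (w 2) : ℤ) with hg
  generalize Int.gcdA (w 0) (w 1) = p at *
  generalize Int.gcdB (w 0) (w 1) = q at *
  generalize Int.gcdA d (w 2) = r at *
  generalize Int.gcdB d (w 2) = t at *
  clear_value g
  clear_value d
  have hg0 : g ≠ 0 := by
    rintro rfl
    apply hw
    ext i
    have hd0 : d = 0 := by rw [hc, zero_mul]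
    fin_cases i
    · change w 0 = 0
      rw [ha, hd0, zero_mul]
    · change w 1 = 0
      rw [hb, hd0, zero_mul]
    · change w 2 = 0
      rw [he, zero_mul]
  refine ⟨g, ![c * a, c * b, e], hg0, ?_, ![r * p, r * q, t], ?_⟩
  · intro i
    fin_cases i <;> simp
    · rw [ha, hc]; ring
    · rw [hb, hc]; ring
    · exact he
  · apply mul_left_cancel₀ hg0
    simp [dt]
    have h0 : w 0 = g * c * a := by rw [ha, hc]
    have h1 : w 1 = g * c * b := by rw [hb, hc]
    calc _ = r * (g * c * a * p + g * c * b * q) + g * e * t := by ring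
      _ = r * d + w 2 * t := by rw [← h0, ← h1, ← e1, ← he]
      _ = g := by rw [e2]; ring

lemma cr_eq_smul {n u p : Fin 3 → ℤ} (hn : Prim n) (hu : dt n u = 0) (hp : dt n p = 0) :
    ∃ k : ℤ, ∀ i, cr u p i = k * n i := by
  obtain ⟨x, hx⟩ := hn
  refine ⟨dt x (cr u p), ?_⟩
  have key : cr (cr u p) n = 0 := by
    ext i
    simp only [dt] at hu hp
    fin_cases i <;> simp [cr]
    · linear_combination p 0 * hu - u 0 * hp
    · linear_combination p 1 * hu - u 1 * hp
    · linear_combination p 2 * hu - u 2 * hp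
  rw [cr_eq_zero_iff] at key
  intro i
  simp only [dt] at hx ⊢
  linear_combination (-cr u p i) * hx + x 0 * key i 0 + x 1 * key i 1 + x 2 * key i 2

/-- points of the box in the plane -/
noncomputable def P (m : ℕ) (n : Fin 3 → ℤ) : Finset (Fin 3 → ℤ) := (B m).filter fun p => dt n p = 0

lemma abs_of_mem_B {m : ℕ} {v : Fin 3 → ℤ} (h : v ∈ B m) (i : Fin 3) : |v i| ≤ m := by
  have := mem_B.1 h i
  rw [abs_le]; constructor <;> omega

lemma dt_sub (n p q : Fin 3 → ℤ) : dt n (p - q) = dt n p - dt n q := by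
  simp [dt]; ring

lemma cr_sub (n p q : Fin 3 → ℤ) : cr n (p - q) = cr n p - cr n q := by
  ext i
  fin_cases i <;> simp [cr] <;> ring

lemma card_P {m : ℕ} {n a b : Fin 3 → ℤ} (hn : Prim n) (ha : a ∈ P m n) (hb : b ∈ P m n)
    (hab : cr a b ≠ 0) : (P m n).card * nm n ≤ 12 * m ^ 2 := by
  have hn0 : n ≠ 0 := by
    rintro rfl
    obtain ⟨x, hx⟩ := hn
    simp [dt] at hx
  have hr := nm_pos hn0
  have ha0 : a ≠ 0 := by
    rintro rfl
    apply hab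
    ext i; fin_cases i <;> simp [cr]
  simp only [P, Finset.mem_filter] at ha hb
  -- shortest vector
  have hex : ∃ s, ∃ u, u ≠ 0 ∧ dt n u = 0 ∧ nm u = s := ⟨_, a, ha0, ha.2, rfl⟩
  classical
  obtain ⟨u, hu0, hnu, hus⟩ := Nat.find_spec hex
  have hmin : ∀ v, v ≠ 0 → dt n v = 0 → nm u ≤ nm v := by
    intro v hv0 hv
    rw [hus]
    exact Nat.find_min' hex ⟨v, hv0, hv, rfl⟩
  clear hus
  have hs := nm_pos hu0
  have hsm : nm u ≤ m := (hmin a ha0 ha.2).trans (nm_le (abs_of_mem_B ha.1))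
  obtain ⟨i, hi⟩ := exists_nm u
  obtain ⟨j, hj⟩ := exists_nm n
  set s := nm u with hsdef
  set r := nm n with hrdef
  have hui : u i ≠ 0 := by
    intro h; rw [h] at hi; simp at hi; omega
  have hnj : n j ≠ 0 := by
    intro h; rw [h] at hj; simp at hj; omega
  have hk : ∀ p, ∃ k : ℤ, p ∈ P m n → (∀ l, cr u p l = k * n l) ∧ |k| * r ≤ 2 * s * m := by
    intro p
    by_cases hp : p ∈ P m n
    · simp only [P, Finset.mem_filter] at hp
      obtain ⟨k, hk⟩ := cr_eq_smul hn hnu hp.2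
      refine ⟨k, fun _ => ⟨hk, ?_⟩⟩
      have := nm_cr_le (abs_le_nm u) (abs_of_mem_B hp.1) j
      rwa [hk, abs_mul, hj] at this
    · exact ⟨0, fun h => absurd h hp⟩
  choose k hk using hk
  -- r ≤ 2 s m
  have hrs : r ≤ 2 * s * m := by
    have hv : ∃ v ∈ P m n, cr u v ≠ 0 := by
      by_contra hcon
      push Not at hcon
      have h1 := cr_eq_zero_iff.1 (hcon a (by simp [P, ha]))
      have h2 := cr_eq_zero_iff.1 (hcon b (by simp [P, hb]))
      apply hab
      rw [cr_eq_zero_iff]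
      intro c d
      apply mul_left_cancel₀ hui
      apply mul_left_cancel₀ hui
      linear_combination (u i * b d) * h1 i c - u i * b c * h1 i d +
        u c * a i * h2 i d - u d * a i * h2 i c
    obtain ⟨v, hvP, hv⟩ := hv
    obtain ⟨h1, h2⟩ := hk v hvP
    have hk0 : k v ≠ 0 := by
      intro h
      apply hv
      ext l
      simp [h1, h]
    have : 1 ≤ |k v| := Int.one_le_abs hk0
    have : (r:ℤ) ≤ 2 * s * m := by nlinarith
    exact_mod_cast this
  set K : ℕ := 2 * s * m / r with hK
  have hcard : (P m n).card ≤ (Finset.Icc (-(K:ℤ)) K ×ˢ Finset.Icc (0:ℤ) ((m / s : ℕ):ℤ)).card := by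
    apply Finset.card_le_card_of_injOn (fun p => (k p, p i / (s:ℤ)))
    · intro p hp
      obtain ⟨h1, h2⟩ := hk p hp
      simp only [Finset.coe_product, Set.mem_prod, Finset.mem_coe, Finset.mem_Icc]
      have hp' := hp
      simp only [P, Finset.coe_filter, Set.mem_ofPred_eq] at hp'
      have hb := mem_B.1 hp'.1 i
      refine ⟨?_, ?_, ?_⟩
      · rw [← abs_le, hK]
        push_cast
        rw [Int.le_ediv_iff_mul_le (by exact_mod_cast hr)]
        exact h2
      · exact Int.ediv_nonneg hb.1 (by positivity)
      · push_cast
        exact Int.ediv_le_ediv (by exact_mod_cast hs) hb.2.le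
    · intro p hp q hq hpq
      simp only [Prod.mk.injEq] at hpq
      obtain ⟨hk1, hd⟩ := hpq
      have hp1 := (hk p hp).1
      have hq1 := (hk q hq).1
      have hc : cr u (p - q) = 0 := by
        rw [cr_sub]
        ext l
        simp [hp1, hq1, hk1]
      have hd0 : dt n (p - q) = 0 := by
        simp only [P, Finset.coe_filter, Set.mem_ofPred_eq] at hp hq
        rw [dt_sub, hp.2, hq.2, sub_zero]
      by_contra hne
      have hne' : p - q ≠ 0 := sub_ne_zero.2 hne
      have hle := hmin _ hne' hd0
      obtain ⟨l, hl⟩ := exists_nm (p - q)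
      have h3 := cr_eq_zero_iff.1 hc i l
      have h4 : (s:ℤ) * |(p - q) l| ≤ s * |(p - q) i| := by
        calc (s:ℤ) * |(p - q) l| = |u l * (p - q) i| := by rw [← h3, abs_mul, hi]
          _ ≤ _ := by
            rw [abs_mul]
            exact mul_le_mul_of_nonneg_right (abs_le_nm u l) (abs_nonneg _)
      have h5 := le_of_mul_le_mul_left h4 (by exact_mod_cast hs)
      rw [hl] at h5
      have h6 : (s:ℤ) ≤ |p i - q i| := by
        have : (s:ℤ) ≤ nm (p - q) := by exact_mod_cast hle
        simpa using this.trans h5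
      have hs' : (0:ℤ) < s := by exact_mod_cast hs
      have e1 := Int.emod_add_mul_ediv (p i) s
      have e2 := Int.emod_add_mul_ediv (q i) s
      rw [hd] at e1
      have := Int.emod_nonneg (p i) hs'.ne'
      have := Int.emod_nonneg (q i) hs'.ne'
      have := Int.emod_lt_of_pos (p i) hs'
      have := Int.emod_lt_of_pos (q i) hs'
      have : |p i - q i| < s := by
        rw [abs_lt]; constructor <;> linarith
      linarith
  rw [Finset.card_product, Int.card_Icc, Int.card_Icc] at hcard
  have c1 : ((K:ℤ) + 1 - -(K:ℤ)).toNat = 2 * K + 1 := by omega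
  have c2 : (((m / s : ℕ):ℤ) + 1 - 0).toNat = m / s + 1 := by
    generalize m / s = z
    omega
  rw [c1, c2] at hcard
  have hKr : K * r ≤ 2 * s * m := Nat.div_mul_le_self _ _
  have hms : (m / s) * s ≤ m := Nat.div_mul_le_self _ _
  have f1 : (2 * K + 1) * r ≤ 6 * s * m := by nlinarith
  have f2 : (m / s + 1) * s ≤ 2 * m := by nlinarith
  have f3 : ((P m n).card * r) * s ≤ (12 * m ^ 2) * s := by
    calc ((P m n).card * r) * s ≤ (((2 * K + 1) * (m / s + 1)) * r) * s := by gcongr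
      _ = ((2 * K + 1) * r) * ((m / s + 1) * s) := by ring
      _ ≤ (6 * s * m) * (2 * m) := Nat.mul_le_mul f1 f2
      _ = _ := by ring
  exact Nat.le_of_mul_le_mul_right f3 hs

/-- shell of radius r -/
noncomputable def shell (r : ℕ) : Finset (Fin 3 → ℤ) :=
  (Fintype.piFinset fun _ => Finset.Icc (-(r:ℤ)) r) \
    (Fintype.piFinset fun _ => Finset.Icc (-(r:ℤ) + 1) (r - 1))

lemma card_shell {r : ℕ} (hr : 1 ≤ r) : (shell r).card ≤ 26 * r ^ 2 := by
  rw [shell, Finset.card_sdiff_of_subset]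
  · simp only [Fintype.card_piFinset, Int.card_Icc, Finset.prod_const, Finset.card_univ,
      Fintype.card_fin]
    have c1 : ((r:ℤ) + 1 - -(r:ℤ)).toNat = 2 * r + 1 := by omega
    have c2 : ((r:ℤ) - 1 + 1 - (-(r:ℤ) + 1)).toNat = 2 * r - 1 := by omega
    rw [c1, c2]
    obtain ⟨t, rfl⟩ : ∃ t, r = t + 1 := ⟨r - 1, by omega⟩
    have : 2 * (t + 1) - 1 = 2 * t + 1 := by omega
    rw [this, Nat.sub_le_iff_le_add]
    nlinarith
  · apply Fintype.piFinset_subset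
    intro _
    apply Finset.Icc_subset_Icc <;> omega

lemma mem_shell (n : Fin 3 → ℤ) : n ∈ shell (nm n) := by
  simp only [shell, Finset.mem_sdiff, Fintype.mem_piFinset, Finset.mem_Icc]
  constructor
  · intro i
    exact abs_le.1 (abs_le_nm n i)
  · intro h
    obtain ⟨i, hi⟩ := exists_nm n
    have h1 := h i
    have : |n i| ≤ nm n - 1 := abs_le.2 ⟨by linarith, h1.2⟩
    omega

open Classical in
/-- normals of rank two triples -/
noncomputable def good (m r : ℕ) : Finset (Fin 3 → ℤ) :=
  (shell r).filter fun n => nm n = r ∧ Prim n ∧ ∃ a ∈ P m n, ∃ b ∈ P m n, cr a b ≠ 0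

/-- triples -/
noncomputable def T (m : ℕ) : Finset (Fin 3 → Fin 3 → ℤ) := Fintype.piFinset fun _ => B m

open Classical in
/-- rank one triples -/
noncomputable def S1 (m : ℕ) : Finset (Fin 3 → Fin 3 → ℤ) :=
  (T m).filter fun f => ∀ i j, cr (f i) (f j) = 0

open Classical in
/-- rank two triples -/
noncomputable def S2 (m : ℕ) : Finset (Fin 3 → Fin 3 → ℤ) :=
  (Finset.Icc 1 (2 * m ^ 2)).biUnion fun r => (good m r).biUnion fun n =>
    Fintype.piFinset fun _ => P m n

lemma card_S1 (m : ℕ) : (S1 m).card ≤ 9 * m ^ 6 := by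
  have h : ∀ f : Fin 3 → Fin 3 → ℤ, ∃ c : Fin 3 × Fin 3, f c.1 c.2 = 0 → f = 0 := by
    intro f
    by_cases hf : f = 0
    · exact ⟨0, fun _ => hf⟩
    · have : ∃ a b, f a b ≠ 0 := by
        by_contra hcon
        push Not at hcon
        exact hf (by ext a b; exact hcon a b)
      obtain ⟨a, b, hab⟩ := this
      exact ⟨(a, b), fun h => absurd h hab⟩
  choose c hc using h
  have : (S1 m).card ≤ ((Finset.univ : Finset (Fin 3 × Fin 3)) ×ˢ (B m ×ˢ B m)).card := by
    apply Finset.card_le_card_of_injOn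
      (fun f => (c f, f (c f).1, fun k => f k (c f).2))
    · intro f hf
      simp only [S1, T, Finset.coe_filter, Set.mem_ofPred_eq, Fintype.mem_piFinset] at hf
      simp only [Finset.coe_product, Set.mem_prod, Finset.mem_coe, Finset.mem_univ, true_and]
      exact ⟨hf.1 _, mem_B.2 fun k => mem_B.1 (hf.1 k) _⟩
    · intro f hf g hg hfg
      simp only [Prod.mk.injEq] at hfg
      obtain ⟨h1, h2, h3⟩ := hfg
      simp only [S1, Finset.coe_filter, Set.mem_ofPred_eq] at hf hg
      have hcg := hc g
      rw [← h1] at h2 h3 hcg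
      have hcf := hc f
      have e0 : f (c f).1 (c f).2 = g (c f).1 (c f).2 := congrFun h2 _
      by_cases h0 : f (c f).1 (c f).2 = 0
      · rw [hcf h0, hcg (e0 ▸ h0)]
      · ext a b
        have k1 := cr_eq_zero_iff.1 (hf.2 (c f).1 a) (c f).2 b
        have k2 := cr_eq_zero_iff.1 (hg.2 (c f).1 a) (c f).2 b
        apply mul_left_cancel₀ h0
        rw [k1, e0, k2, congrFun h2 b]
        congr 1
        exact congrFun h3 a
  refine this.trans ?_
  simp [Finset.card_product, card_B]
  ring_nf
  rfl

lemma card_S2 (m : ℕ) : ((S2 m).card : ℝ) ≤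
    44928 * (m:ℝ) ^ 6 * ∑ r ∈ Finset.Icc (1:ℕ) (2 * m ^ 2), ((r:ℕ):ℝ)⁻¹ := by
  classical
  have h1 : (S2 m).card ≤ ∑ r ∈ Finset.Icc 1 (2 * m ^ 2), ∑ n ∈ good m r, (P m n).card ^ 3 := by
    refine Finset.card_biUnion_le.trans (Finset.sum_le_sum fun r _ => ?_)
    refine Finset.card_biUnion_le.trans (Finset.sum_le_sum fun n _ => ?_)
    simp
  have h2 : ((S2 m).card : ℝ) ≤
      ∑ r ∈ Finset.Icc 1 (2 * m ^ 2), ∑ n ∈ good m r, ((P m n).card : ℝ) ^ 3 := by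
    exact_mod_cast h1
  refine h2.trans ?_
  rw [Finset.mul_sum]
  refine Finset.sum_le_sum fun r hr => ?_
  have hr1 := (Finset.mem_Icc.1 hr).1
  have hr0 : (0:ℝ) < r := by exact_mod_cast hr1
  have h3 : ∀ n ∈ good m r, ((P m n).card : ℝ) ^ 3 ≤ (12 * (m:ℝ) ^ 2 / r) ^ 3 := by
    intro n hn
    simp only [good, Finset.mem_filter] at hn
    obtain ⟨-, hnr, hp, a, ha, b, hb, hab⟩ := hn
    have := card_P hp ha hb hab
    rw [hnr] at this
    gcongr
    rw [le_div_iff₀ hr0]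
    exact_mod_cast this
  have h4 : ((good m r).card : ℝ) ≤ 26 * (r:ℝ) ^ 2 := by
    have : (good m r).card ≤ 26 * r ^ 2 := by
      refine le_trans (Finset.card_le_card ?_) (card_shell hr1)
      exact Finset.filter_subset _ _
    exact_mod_cast this
  calc _ ≤ ((good m r).card : ℝ) * (12 * (m:ℝ) ^ 2 / r) ^ 3 := by
        have := Finset.sum_le_card_nsmul _ _ _ h3
        simpa using this
    _ ≤ (26 * (r:ℝ) ^ 2) * (12 * (m:ℝ) ^ 2 / r) ^ 3 := by gcongr
    _ = _ := by field_simp; ring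

lemma cover {m : ℕ} {f : Fin 3 → Fin 3 → ℤ} (hf : f ∈ T m) (hdet : (Matrix.of f).det = 0) :
    f ∈ S1 m ∨ f ∈ S2 m := by
  classical
  by_cases h : ∀ i j, cr (f i) (f j) = 0
  · left
    simp [S1, hf, h]
  right
  push Not at h
  obtain ⟨a, b, hab⟩ := h
  obtain ⟨g, n, hg, hw, hn⟩ := exists_prim hab
  have hB : ∀ k, f k ∈ B m := by simpa [T] using hf
  have hort : ∀ k, dt n (f k) = 0 := by
    intro k
    apply mul_left_cancel₀ hg
    have : g * dt n (f k) = dt (cr (f a) (f b)) (f k) := by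
      simp only [dt, hw]; ring
    rw [this, mul_zero]
    rw [Matrix.det_fin_three] at hdet
    simp only [Matrix.of_apply] at hdet
    fin_cases a <;> fin_cases b <;> fin_cases k <;> simp [dt, cr] <;>
      first
        | ring1
        | linear_combination hdet
        | linear_combination -hdet
  have hP : ∀ k, f k ∈ P m n := fun k => by simp [P, hB, hort]
  have hn0 : n ≠ 0 := by
    rintro rfl
    obtain ⟨x, hx⟩ := hn
    simp [dt] at hx
  simp only [S2, Finset.mem_biUnion]
  refine ⟨nm n, ?_, n, ?_, ?_⟩
  · rw [Finset.mem_Icc]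
    refine ⟨nm_pos hn0, nm_le fun i => ?_⟩
    have h1 := nm_cr_le (abs_of_mem_B (hB a)) (abs_of_mem_B (hB b)) i
    rw [hw, abs_mul] at h1
    have := Int.one_le_abs hg
    have := abs_nonneg (n i)
    push_cast
    nlinarith
  · simp only [good, Finset.mem_filter]
    exact ⟨mem_shell n, trivial, hn, f a, hP a, f b, hP b, hab⟩
  · simpa using hP

lemma det_zero {f : Fin 3 → Fin 3 → ℤ} (h : Module.finrank ℝ (Submodule.span ℝ
            (Set.range (fun j => fun i => ((f j i : ℝ))))) ≤ 2) : (Matrix.of f).det = 0 := by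
  by_contra hd
  have hR : Matrix.det (Matrix.map (Matrix.of f) (Int.castRingHom ℝ)) ≠ 0 := by
    have := RingHom.map_det (Int.castRingHom ℝ) (Matrix.of f)
    rw [RingHom.mapMatrix_apply] at this
    rw [← this]
    simpa using hd
  have hl := Matrix.linearIndependent_rows_of_det_ne_zero hR
  have : Module.finrank ℝ (Submodule.span ℝ
      (Set.range (fun j => fun i => ((f j i : ℝ))))) = Fintype.card (Fin 3) :=
    finrank_span_eq_card hl
  rw [Fintype.card_fin] at this
  omega

end Copl

/-- The number of ordered 3-tuples of points of `[m]^3` lying on a common plane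
through the origin is `O(m^6 log m)`. -/
theorem stmt8 :
    ∃ C : ℝ, 0 < C ∧ ∀ m : ℕ, 2 ≤ m →
      (Nat.card {f : Fin 3 → (Fin 3 → ℤ) //
          (∀ j i, 0 ≤ f j i ∧ f j i < (m : ℤ)) ∧
          Module.finrank ℝ (Submodule.span ℝ
            (Set.range (fun j => fun i => ((f j i : ℝ))))) ≤ 2} : ℝ)
        ≤ C * (m : ℝ) ^ 6 * Real.log m := by
  classical
  refine ⟨300000, by norm_num, fun m hm => ?_⟩
  have h1 : Nat.card {f : Fin 3 → (Fin 3 → ℤ) //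
          (∀ j i, 0 ≤ f j i ∧ f j i < (m : ℤ)) ∧
          Module.finrank ℝ (Submodule.span ℝ
            (Set.range (fun j => fun i => ((f j i : ℝ))))) ≤ 2} ≤
      (Copl.S1 m ∪ Copl.S2 m).card := by
    rw [← Nat.card_eq_finsetCard]
    refine Nat.card_le_card_of_injective (fun f => ⟨f.1, ?_⟩) ?_
    · have hT : f.1 ∈ Copl.T m := by
        simp only [Copl.T, Fintype.mem_piFinset, Copl.mem_B]
        exact f.2.1
      exact Finset.mem_union.2 (Copl.cover hT (Copl.det_zero f.2.2))
    · intro f g hfg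
      simpa [Subtype.ext_iff] using hfg
  have h2 : (Copl.S1 m ∪ Copl.S2 m).card ≤ 9 * m ^ 6 + (Copl.S2 m).card :=
    (Finset.card_union_le _ _).trans (Nat.add_le_add_right (Copl.card_S1 m) _)
  have h3 := Copl.card_S2 m
  have hm2 : (2:ℝ) ≤ m := by exact_mod_cast hm
  have hlog : Real.log 2 ≤ Real.log m := Real.log_le_log (by norm_num) hm2
  have hl2 := Real.log_two_gt_d9
  have hh : ∑ r ∈ Finset.Icc (1:ℕ) (2 * m ^ 2), ((r:ℕ):ℝ)⁻¹ ≤ 5 * Real.log m := by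
    have := harmonic_le_one_add_log (2 * m ^ 2)
    rw [harmonic_eq_sum_Icc] at this
    push_cast at this
    rw [Real.log_mul (by norm_num) (by positivity), Real.log_pow] at this
    push_cast at this
    linarith
  have h4 : (Nat.card {f : Fin 3 → (Fin 3 → ℤ) //
          (∀ j i, 0 ≤ f j i ∧ f j i < (m : ℤ)) ∧
          Module.finrank ℝ (Submodule.span ℝ
            (Set.range (fun j => fun i => ((f j i : ℝ))))) ≤ 2} : ℝ) ≤
      9 * (m:ℝ) ^ 6 + (Copl.S2 m).card := by
    exact_mod_cast h1.trans h2
  have hm6 : (0:ℝ) ≤ (m:ℝ) ^ 6 := by positivity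
  have h5 : 44928 * (m:ℝ) ^ 6 * ∑ r ∈ Finset.Icc (1:ℕ) (2 * m ^ 2), ((r:ℕ):ℝ)⁻¹ ≤
      44928 * (m:ℝ) ^ 6 * (5 * Real.log m) := by gcongr
  have h6 : (m:ℝ) ^ 6 * 1 ≤ (m:ℝ) ^ 6 * (2 * Real.log m) := by
    gcongr; linarith
  have h7 : 0 ≤ (m:ℝ) ^ 6 * Real.log m := mul_nonneg hm6 (by linarith)
  linarith
end

section
/- The number of ordered coplanar 4-tuples of points in [m]^3 is O(m^9 log m). -/
lemma red_aux (m D s t a b X : ℤ) (hD : D ≠ 0) (ha : |a| ≤ m) (hb : |b| ≤ m)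
    (h : D * X = s * a + t * b) : |X - (s / D) * a - (t / D) * b| ≤ 2 * m := by
  have e : D * (X - (s / D) * a - (t / D) * b) = (s % D) * a + (t % D) * b := by
    have h1 := Int.emod_add_mul_ediv s D
    have h2 := Int.emod_add_mul_ediv t D
    linear_combination h - a * h1 - b * h2
  have hs0 := Int.emod_nonneg s hD
  have ht0 := Int.emod_nonneg t hD
  have hs1 := Int.emod_lt_abs s hD
  have ht1 := Int.emod_lt_abs t hD
  have hDp : 0 < |D| := abs_pos.mpr hD
  have hm : 0 ≤ m := (abs_nonneg a).trans ha
  have : |D| * |X - (s / D) * a - (t / D) * b| ≤ |D| * (2 * m) := by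
    rw [← abs_mul, e]
    calc _ ≤ |s % D * a| + |t % D * b| := abs_add_le _ _
      _ = (s % D) * |a| + (t % D) * |b| := by rw [abs_mul, abs_mul, abs_of_nonneg hs0, abs_of_nonneg ht0]
      _ ≤ |D| * m + |D| * m := by gcongr
      _ = _ := by ring
  exact le_of_mul_le_mul_left this hDp

lemma key {α : Type*} (S : Finset α) (x y z : α → ℤ)
    (inj : ∀ s ∈ S, ∀ t ∈ S, x s = x t → y s = y t → z s = z t → s = t)
    (m : ℕ) (hx : ∀ s ∈ S, |x s| ≤ m) (hy : ∀ s ∈ S, |y s| ≤ m)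
    (n1 n2 n3 : ℤ) (orth : ∀ s ∈ S, n1 * x s + n2 * y s + n3 * z s = 0)
    (p q r : ℤ) (bez : p * n1 + q * n2 + r * n3 = 1)
    (a1 a2 a3 b1 b2 b3 : ℤ) (ha1 : |a1| ≤ m) (ha2 : |a2| ≤ m) (hb1 : |b1| ≤ m) (hb2 : |b2| ≤ m)
    (ha : n1 * a1 + n2 * a2 + n3 * a3 = 0) (hb : n1 * b1 + n2 * b2 + n3 * b3 = 0)
    (hD : n3 ≠ 0 → a1 * b2 - a2 * b1 ≠ 0) :
    S.card * n3.natAbs ≤ (6 * m + 1) ^ 2 := by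
  by_cases h3 : n3 = 0
  · simp [h3]
  replace hD := hD h3
  have ex : ∀ k : ℤ, ∃ X Y : ℤ, |X| ≤ 2 * m ∧ |Y| ≤ 2 * m ∧ n3 ∣ n1 * X + n2 * Y - k := by
    intro k
    set D := a1 * b2 - a2 * b1 with hDd
    set s := k * p * b2 - k * q * b1 with hs
    set t := a1 * (k * q) - a2 * (k * p) with ht
    refine ⟨k * p - (s / D) * a1 - (t / D) * b1, k * q - (s / D) * a2 - (t / D) * b2,
      red_aux _ _ _ _ _ _ _ hD ha1 hb1 (by rw [hDd, hs, ht]; ring),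
      red_aux _ _ _ _ _ _ _ hD ha2 hb2 (by rw [hDd, hs, ht]; ring),
      ⟨(s / D) * a3 + (t / D) * b3 - k * r, ?_⟩⟩
    linear_combination k * bez - (s / D) * ha - (t / D) * hb
  choose X Y hX hY hXY using ex
  have := Finset.card_le_card_of_injOn (s := S ×ˢ Finset.range n3.natAbs)
    (t := Finset.Icc (-(3 * m : ℤ)) (3 * m) ×ˢ Finset.Icc (-(3 * m : ℤ)) (3 * m))
    (fun c => (x c.1 + X c.2, y c.1 + Y c.2)) ?_ ?_
  · rw [Finset.card_product, Finset.card_product, Finset.card_range, Int.card_Icc] at this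
    have e : (3 * (m:ℤ) + 1 - -(3 * m)).toNat = 6 * m + 1 := by omega
    rw [e] at this
    rw [sq]; exact this
  · rintro ⟨c, k⟩ hc
    simp only [Finset.coe_product, Set.mem_prod, Finset.mem_coe, Finset.mem_Icc] at hc ⊢
    have h1 := abs_le.mp (hx c hc.1)
    have h2 := abs_le.mp (hy c hc.1)
    have h3 := abs_le.mp (hX k)
    have h4 := abs_le.mp (hY k)
    omega
  · rintro ⟨c, k⟩ hc ⟨d, l⟩ hd h
    simp only [Finset.coe_product, Set.mem_prod, Finset.mem_coe, Finset.mem_range, Prod.mk.injEq] at hc hd h ⊢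
    have hkl : k = l := by
      obtain ⟨A, hA⟩ := hXY k
      obtain ⟨B, hB⟩ := hXY l
      have o1 := orth c hc.1
      have o2 := orth d hd.1
      have hdv : n3 ∣ (k : ℤ) - l := ⟨z c - z d - A + B, by
        linear_combination hB - hA + n1 * h.1 + n2 * h.2 - o1 + o2⟩
      have hlt : |(k:ℤ) - l| < |n3| := by
        rw [← Int.natCast_natAbs n3, abs_lt]
        clear hA hB o1 o2 h
        omega
      have := Int.eq_zero_of_abs_lt_dvd ((abs_dvd _ _).mpr hdv) hlt
      clear hA hB o1 o2 h
      omega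
    subst hkl
    refine ⟨inj c hc.1 d hd.1 (by linarith) (by linarith) ?_, rfl⟩
    apply mul_left_cancel₀ h3
    have o1 := orth c hc.1
    have o2 := orth d hd.1
    linear_combination o1 - o2 - n1 * h.1 - n2 * h.2

noncomputable def cube (m : ℕ) : Finset (ℤ × ℤ × ℤ) :=
  Finset.Icc (-(m : ℤ)) m ×ˢ Finset.Icc (-(m : ℤ)) m ×ˢ Finset.Icc (-(m : ℤ)) m

lemma mem_cube (m : ℕ) (a : ℤ × ℤ × ℤ) : a ∈ cube m ↔ |a.1| ≤ m ∧ |a.2.1| ≤ m ∧ |a.2.2| ≤ m := by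
  simp [cube, abs_le]

lemma card_cube (m : ℕ) : (cube m).card = (2 * m + 1) ^ 3 := by
  have e : ((m:ℤ) + 1 - -(m:ℤ)).toNat = 2 * m + 1 := by omega
  simp only [cube, Finset.card_product, Int.card_Icc, e]
  ring

def dot (a b : ℤ × ℤ × ℤ) : ℤ := a.1 * b.1 + a.2.1 * b.2.1 + a.2.2 * b.2.2

def crs (a b : ℤ × ℤ × ℤ) : ℤ × ℤ × ℤ :=
  (a.2.1 * b.2.2 - a.2.2 * b.2.1, a.2.2 * b.1 - a.1 * b.2.2, a.1 * b.2.1 - a.2.1 * b.1)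

def nrm (a : ℤ × ℤ × ℤ) : ℕ := max a.1.natAbs (max a.2.1.natAbs a.2.2.natAbs)

lemma nrm_le (k : ℕ) (a : ℤ × ℤ × ℤ) : nrm a ≤ k ↔ a ∈ cube k := by
  rw [mem_cube]
  simp only [nrm, ← Int.natCast_natAbs]
  omega

def good (m : ℕ) (n : ℤ × ℤ × ℤ) : Prop :=
  (∃ p q r : ℤ, p * n.1 + q * n.2.1 + r * n.2.2 = 1) ∧
  ∃ a ∈ cube m, ∃ b ∈ cube m, ∃ g : ℤ, g ≠ 0 ∧ crs a b = (g * n.1, g * n.2.1, g * n.2.2)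

lemma good_card (m : ℕ) (n : ℤ × ℤ × ℤ) (h : good m n) :
    ((cube m).filter (fun w => dot n w = 0)).card * nrm n ≤ (6 * m + 1) ^ 2 := by
  obtain ⟨⟨p, q, r, bez⟩, a, ha, b, hb, g, hg, hc⟩ := h
  simp only [crs, Prod.mk.injEq] at hc
  obtain ⟨c1, c2, c3⟩ := hc
  rw [mem_cube] at ha hb
  have oa : n.1 * a.1 + n.2.1 * a.2.1 + n.2.2 * a.2.2 = 0 := by
    apply mul_left_cancel₀ hg
    linear_combination - a.1 * c1 - a.2.1 * c2 - a.2.2 * c3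
  have ob : n.1 * b.1 + n.2.1 * b.2.1 + n.2.2 * b.2.2 = 0 := by
    apply mul_left_cancel₀ hg
    linear_combination - b.1 * c1 - b.2.1 * c2 - b.2.2 * c3
  set S := (cube m).filter (fun w => dot n w = 0) with hS
  have hmem : ∀ s ∈ S, (|s.1| ≤ m ∧ |s.2.1| ≤ m ∧ |s.2.2| ≤ m) ∧
      n.1 * s.1 + n.2.1 * s.2.1 + n.2.2 * s.2.2 = 0 := by
    intro s hs
    rw [hS, Finset.mem_filter, mem_cube] at hs
    exact hs
  have k3 := key S (fun s => s.1) (fun s => s.2.1) (fun s => s.2.2)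
    (fun s _ t _ h1 h2 h3 => Prod.ext h1 (Prod.ext h2 h3)) m
    (fun s hs => (hmem s hs).1.1) (fun s hs => (hmem s hs).1.2.1) n.1 n.2.1 n.2.2
    (fun s hs => (hmem s hs).2) p q r bez a.1 a.2.1 a.2.2 b.1 b.2.1 b.2.2
    ha.1 ha.2.1 hb.1 hb.2.1 oa ob (fun h => by rw [c3]; exact mul_ne_zero hg h)
  have k1 := key S (fun s => s.2.1) (fun s => s.2.2) (fun s => s.1)
    (fun s _ t _ h1 h2 h3 => Prod.ext h3 (Prod.ext h1 h2)) m
    (fun s hs => (hmem s hs).1.2.1) (fun s hs => (hmem s hs).1.2.2) n.2.1 n.2.2 n.1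
    (fun s hs => by linear_combination (hmem s hs).2) q r p (by linear_combination bez)
    a.2.1 a.2.2 a.1 b.2.1 b.2.2 b.1
    ha.2.1 ha.2.2 hb.2.1 hb.2.2 (by linear_combination oa) (by linear_combination ob)
    (fun h => by rw [c1]; exact mul_ne_zero hg h)
  have k2 := key S (fun s => s.2.2) (fun s => s.1) (fun s => s.2.1)
    (fun s _ t _ h1 h2 h3 => Prod.ext h2 (Prod.ext h3 h1)) m
    (fun s hs => (hmem s hs).1.2.2) (fun s hs => (hmem s hs).1.1) n.2.2 n.1 n.2.1
    (fun s hs => by linear_combination (hmem s hs).2) r p q (by linear_combination bez)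
    a.2.2 a.1 a.2.1 b.2.2 b.1 b.2.1
    ha.2.2 ha.1 hb.2.2 hb.1 (by linear_combination oa) (by linear_combination ob)
    (fun h => by rw [c2]; exact mul_ne_zero hg h)
  unfold nrm
  rcases max_choice n.1.natAbs (max n.2.1.natAbs n.2.2.natAbs) with h | h
  · rw [h]; exact k1
  · rw [h]
    rcases max_choice n.2.1.natAbs n.2.2.natAbs with h | h
    · rw [h]; exact k2
    · rw [h]; exact k3

lemma good_bd (m : ℕ) (n : ℤ × ℤ × ℤ) (h : good m n) : n ∈ cube (2 * m ^ 2) ∧ 1 ≤ nrm n := by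
  obtain ⟨⟨p, q, r, bez⟩, a, ha, b, hb, g, hg, hc⟩ := h
  simp only [crs, Prod.mk.injEq] at hc
  obtain ⟨c1, c2, c3⟩ := hc
  rw [mem_cube] at ha hb
  have aux : ∀ x y z w k : ℤ, |x| ≤ m → |y| ≤ m → |z| ≤ m → |w| ≤ m → x * y - z * w = g * k →
      |k| ≤ ((2 * m ^ 2 : ℕ) : ℤ) := by
    intro x y z w k hx hy hz hw h
    have h1 : |g * k| ≤ 2 * m ^ 2 := by
      rw [← h]
      calc _ ≤ |x * y| + |z * w| := abs_sub _ _
        _ = |x| * |y| + |z| * |w| := by rw [abs_mul, abs_mul]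
        _ ≤ m * m + m * m := by gcongr
        _ = _ := by ring
    rw [abs_mul] at h1
    have h2 : 1 ≤ |g| := Int.one_le_abs hg
    push_cast
    nlinarith [abs_nonneg k]
  refine ⟨?_, ?_⟩
  · rw [mem_cube]
    exact ⟨aux _ _ _ _ _ ha.2.1 hb.2.2 ha.2.2 hb.2.1 c1, aux _ _ _ _ _ ha.2.2 hb.1 ha.1 hb.2.2 c2,
      aux _ _ _ _ _ ha.1 hb.2.1 ha.2.1 hb.1 c3⟩
  · by_contra h0
    have : nrm n ≤ 0 := by omega
    simp only [nrm] at this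
    have e1 : n.1 = 0 := by omega
    have e2 : n.2.1 = 0 := by omega
    have e3 : n.2.2 = 0 := by omega
    rw [e1, e2, e3] at bez
    simp at bez

lemma exists_good (m : ℕ) (a b w : ℤ × ℤ × ℤ) (ha : a ∈ cube m) (hb : b ∈ cube m)
    (hne : crs a b ≠ 0) (hw : dot (crs a b) w = 0) :
    ∃ n, good m n ∧ dot n a = 0 ∧ dot n b = 0 ∧ dot n w = 0 := by
  have bz : ∀ c1 c2 c3 : ℤ, ¬ (c1 = 0 ∧ c2 = 0 ∧ c3 = 0) → ∃ g n1 n2 n3 p q r : ℤ, g ≠ 0 ∧ c1 = g * n1 ∧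
      c2 = g * n2 ∧ c3 = g * n3 ∧ p * n1 + q * n2 + r * n3 = 1 := by
    intro c1 c2 c3 hc
    have e1 := Int.gcd_eq_gcd_ab c2 c3
    have e2 := Int.gcd_eq_gcd_ab c1 (Int.gcd c2 c3)
    have hg : ((Int.gcd c1 (Int.gcd c2 c3) : ℕ) : ℤ) ≠ 0 := by
      intro h
      apply hc
      have := Int.gcd_eq_zero_iff.mp (Int.natCast_eq_zero.mp h)
      have h2 := Int.gcd_eq_zero_iff.mp (Int.natCast_eq_zero.mp this.2)
      exact ⟨this.1, h2.1, h2.2⟩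
    obtain ⟨n1, h1⟩ := Int.gcd_dvd_left c1 (Int.gcd c2 c3)
    obtain ⟨d, h2⟩ := Int.gcd_dvd_right c1 (Int.gcd c2 c3)
    obtain ⟨n2, h3⟩ := Int.gcd_dvd_left c2 c3
    obtain ⟨n3, h4⟩ := Int.gcd_dvd_right c2 c3
    generalize Int.gcdA c1 (Int.gcd c2 c3) = P at *
    generalize Int.gcdB c1 (Int.gcd c2 c3) = Q at *
    generalize Int.gcdA c2 c3 = R at *
    generalize Int.gcdB c2 c3 = T at *
    generalize ((Int.gcd c1 (Int.gcd c2 c3) : ℕ) : ℤ) = g at *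
    generalize ((Int.gcd c2 c3 : ℕ) : ℤ) = e at *
    refine ⟨g, n1, d * n2, d * n3, P, Q * R, Q * T, hg, h1, ?_, ?_, ?_⟩
    · rw [← mul_assoc, ← h2, ← h3]
    · rw [← mul_assoc, ← h2, ← h4]
    · apply mul_left_cancel₀ hg
      linear_combination -P * h1 - Q * d * n2 * h2 * 0 - e2 - Q * e1 - Q * R * (h3 + n2 * h2) - Q * T * (h4 + n3 * h2)
  obtain ⟨g, n1, n2, n3, p, q, r, hg, h1, h2, h3, hb1⟩ := bz (crs a b).1 (crs a b).2.1 (crs a b).2.2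
    (fun h => hne (Prod.ext h.1 (Prod.ext h.2.1 h.2.2)))
  refine ⟨(n1, n2, n3), ⟨⟨p, q, r, hb1⟩, a, ha, b, hb, g, hg, Prod.ext h1 (Prod.ext h2 h3)⟩, ?_, ?_, ?_⟩
  · apply mul_left_cancel₀ hg
    simp only [dot, crs] at *
    linear_combination - a.1 * h1 - a.2.1 * h2 - a.2.2 * h3
  · apply mul_left_cancel₀ hg
    simp only [dot, crs] at *
    linear_combination - b.1 * h1 - b.2.1 * h2 - b.2.2 * h3
  · apply mul_left_cancel₀ hg
    simp only [dot] at *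
    linear_combination hw - w.1 * h1 - w.2.1 * h2 - w.2.2 * h3

lemma sphere_card (k : ℕ) (M : ℕ) (hk : 1 ≤ k) :
    ((cube M).filter (fun n => nrm n = k)).card ≤ 26 * k ^ 2 := by
  have hsub : (cube M).filter (fun n => nrm n = k) ⊆ cube k \ cube (k - 1) := by
    intro n hn
    rw [Finset.mem_filter] at hn
    rw [Finset.mem_sdiff, ← nrm_le, ← nrm_le]
    omega
  refine (Finset.card_le_card hsub).trans ?_
  obtain ⟨j, rfl⟩ : ∃ j, k = j + 1 := ⟨k - 1, by omega⟩
  rw [Finset.card_sdiff_of_subset, card_cube, card_cube]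
  · simp only [Nat.add_sub_cancel]
    rw [Nat.sub_le_iff_le_add]
    nlinarith
  · intro n hn
    rw [← nrm_le] at hn ⊢
    omega

lemma sum_nrm (M : ℕ) :
    ∑ n ∈ (cube M).filter (fun n => 1 ≤ nrm n), (1 : ℝ) / (nrm n : ℝ) ^ 3 ≤ 26 * (1 + Real.log M) := by
  have hmap : ∀ n ∈ (cube M).filter (fun n => 1 ≤ nrm n), nrm n ∈ Finset.Icc 1 M := by
    intro n hn
    rw [Finset.mem_filter, ← nrm_le] at hn
    rw [Finset.mem_Icc]; omega
  rw [← Finset.sum_fiberwise_of_maps_to hmap]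
  calc _ ≤ ∑ k ∈ Finset.Icc 1 M, 26 * ((k : ℝ))⁻¹ := by
        apply Finset.sum_le_sum
        intro k hk
        rw [Finset.mem_Icc] at hk
        have hk0 : (0:ℝ) < k := by exact_mod_cast hk.1
        rw [Finset.sum_congr rfl (g := fun _ => (1:ℝ) / (k:ℝ)^3)]
        · rw [Finset.sum_const, nsmul_eq_mul]
          have : ((((cube M).filter (fun n => 1 ≤ nrm n)).filter (fun n => nrm n = k)).card : ℝ) ≤ 26 * (k:ℝ)^2 := by
            have h1 := sphere_card k M hk.1
            have h2 : (((cube M).filter (fun n => 1 ≤ nrm n)).filter (fun n => nrm n = k)).card ≤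
              ((cube M).filter (fun n => nrm n = k)).card :=
              Finset.card_le_card (Finset.filter_subset_filter _ (Finset.filter_subset _ _))
            exact_mod_cast h2.trans h1
          calc _ ≤ 26 * (k:ℝ)^2 * (1 / (k:ℝ)^3) := by gcongr
            _ = _ := by field_simp
        · intro n hn
          rw [(Finset.mem_filter.mp hn).2]
    _ = 26 * (harmonic M : ℝ) := by
        rw [← Finset.mul_sum, harmonic_eq_sum_Icc]
        push_cast; rfl
    _ ≤ _ := by gcongr; exact harmonic_le_one_add_log M

noncomputable def sing (m : ℕ) : Finset ((ℤ × ℤ × ℤ) × (ℤ × ℤ × ℤ) × (ℤ × ℤ × ℤ)) :=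
  (cube m ×ˢ cube m ×ˢ cube m).filter (fun t => dot (crs t.1 t.2.1) t.2.2 = 0)

lemma inj_card (m : ℕ) (P : ℤ × ℤ × ℤ → ℤ × ℤ × ℤ → ℤ × ℤ × ℤ → Prop)
    [DecidablePred fun t : (ℤ × ℤ × ℤ) × (ℤ × ℤ × ℤ) × (ℤ × ℤ × ℤ) => P t.1 t.2.1 t.2.2]
    (f : ℤ × ℤ × ℤ → ℤ) (hf : ∀ v ∈ cube m, |f v| ≤ m)
    (hP : ∀ u v w v' w', P u v w → P u v' w' → f v = f v' → f w = f w' → v = v' ∧ w = w') :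
    ((cube m ×ˢ cube m ×ˢ cube m).filter (fun t => P t.1 t.2.1 t.2.2)).card ≤ (2 * m + 1) ^ 6 := by
  have := Finset.card_le_card_of_injOn
    (s := (cube m ×ˢ cube m ×ˢ cube m).filter (fun t => P t.1 t.2.1 t.2.2))
    (t := cube m ×ˢ Finset.Icc (-(m:ℤ)) m ×ˢ Finset.Icc (-(m:ℤ)) m)
    (fun t => (t.1, f t.2.1, f t.2.2)) ?_ ?_
  · refine this.trans ?_
    have e : ((m:ℤ) + 1 - -(m:ℤ)).toNat = 2 * m + 1 := by omega
    rw [Finset.card_product, Finset.card_product, card_cube, Int.card_Icc, e]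
    calc _ = (2 * m + 1) ^ 5 := by ring
      _ ≤ _ := Nat.pow_le_pow_right (by omega) (by omega)
  · rintro ⟨u, v, w⟩ h
    simp only [Finset.coe_filter, Set.mem_ofPred_eq, Finset.mem_product] at h
    simp only [Finset.mem_coe, Finset.mem_product, Finset.mem_Icc]
    exact ⟨h.1.1, abs_le.mp (hf v h.1.2.1), abs_le.mp (hf w h.1.2.2)⟩
  · rintro ⟨u, v, w⟩ h ⟨u', v', w'⟩ h' e
    simp only [Finset.coe_filter, Set.mem_ofPred_eq, Finset.mem_product] at h h'
    simp only [Prod.mk.injEq] at e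
    obtain ⟨rfl, e1, e2⟩ := e
    obtain ⟨rfl, rfl⟩ := hP u v w v' w' h.2 h'.2 e1 e2
    rfl

lemma par1 (u v v' : ℤ × ℤ × ℤ) (hu : u.1 ≠ 0) (h : crs u v = 0) (h' : crs u v' = 0)
    (e : v.1 = v'.1) : v = v' := by
  simp only [crs, Prod.mk_eq_zero] at h h'
  refine Prod.ext e (Prod.ext (mul_left_cancel₀ hu ?_) (mul_left_cancel₀ hu ?_))
  · linear_combination h.2.2 - h'.2.2 + u.2.1 * e
  · linear_combination -h.2.1 + h'.2.1 + u.2.2 * e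

lemma par2 (u v v' : ℤ × ℤ × ℤ) (hu : u.2.1 ≠ 0) (h : crs u v = 0) (h' : crs u v' = 0)
    (e : v.2.1 = v'.2.1) : v = v' := by
  simp only [crs, Prod.mk_eq_zero] at h h'
  refine Prod.ext (mul_left_cancel₀ hu ?_) (Prod.ext e (mul_left_cancel₀ hu ?_))
  · linear_combination -h.2.2 + h'.2.2 + u.1 * e
  · linear_combination h.1 - h'.1 + u.2.2 * e

lemma par3 (u v v' : ℤ × ℤ × ℤ) (hu : u.2.2 ≠ 0) (h : crs u v = 0) (h' : crs u v' = 0)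
    (e : v.2.2 = v'.2.2) : v = v' := by
  simp only [crs, Prod.mk_eq_zero] at h h'
  refine Prod.ext (mul_left_cancel₀ hu ?_) (Prod.ext (mul_left_cancel₀ hu ?_) e)
  · linear_combination h.2.1 - h'.2.1 + u.1 * e
  · linear_combination -h.1 + h'.1 + u.2.1 * e

open Classical in
lemma sing_card (m : ℕ) : (sing m).card ≤ 4 * (2 * m + 1) ^ 6 +
    ∑ n ∈ (cube (2 * m ^ 2)).filter (fun n => good m n),
      ((cube m).filter (fun w => dot n w = 0)).card ^ 3 := by
  set T := cube m ×ˢ cube m ×ˢ cube m with hT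
  set L := fun n : ℤ × ℤ × ℤ => (cube m).filter (fun w => dot n w = 0) with hL
  set G := (cube (2 * m ^ 2)).filter (fun n => good m n) with hG
  set Z0 := ({0} : Finset (ℤ × ℤ × ℤ)) ×ˢ cube m ×ˢ cube m with hZ0
  set Z1 := T.filter (fun t => t.1.1 ≠ 0 ∧ crs t.1 t.2.1 = 0 ∧ crs t.1 t.2.2 = 0) with hZ1
  set Z2 := T.filter (fun t => t.1.2.1 ≠ 0 ∧ crs t.1 t.2.1 = 0 ∧ crs t.1 t.2.2 = 0) with hZ2
  set Z3 := T.filter (fun t => t.1.2.2 ≠ 0 ∧ crs t.1 t.2.1 = 0 ∧ crs t.1 t.2.2 = 0) with hZ3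
  have c0 : Z0.card ≤ (2 * m + 1) ^ 6 := by
    rw [hZ0, Finset.card_product, Finset.card_product, card_cube, Finset.card_singleton]
    apply le_of_eq; ring
  have c1 : Z1.card ≤ (2 * m + 1) ^ 6 :=
    inj_card m (fun u v w => u.1 ≠ 0 ∧ crs u v = 0 ∧ crs u w = 0) (fun v => v.1)
      (fun v hv => ((mem_cube _ _).mp hv).1)
      (fun u v w v' w' h h' e1 e2 =>
        ⟨par1 u v v' h.1 h.2.1 h'.2.1 e1, par1 u w w' h.1 h.2.2 h'.2.2 e2⟩)
  have c2 : Z2.card ≤ (2 * m + 1) ^ 6 :=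
    inj_card m (fun u v w => u.2.1 ≠ 0 ∧ crs u v = 0 ∧ crs u w = 0) (fun v => v.2.1)
      (fun v hv => ((mem_cube _ _).mp hv).2.1)
      (fun u v w v' w' h h' e1 e2 =>
        ⟨par2 u v v' h.1 h.2.1 h'.2.1 e1, par2 u w w' h.1 h.2.2 h'.2.2 e2⟩)
  have c3 : Z3.card ≤ (2 * m + 1) ^ 6 :=
    inj_card m (fun u v w => u.2.2 ≠ 0 ∧ crs u v = 0 ∧ crs u w = 0) (fun v => v.2.2)
      (fun v hv => ((mem_cube _ _).mp hv).2.2)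
      (fun u v w v' w' h h' e1 e2 =>
        ⟨par3 u v v' h.1 h.2.1 h'.2.1 e1, par3 u w w' h.1 h.2.2 h'.2.2 e2⟩)
  have c4 : (G.biUnion (fun n => L n ×ˢ L n ×ˢ L n)).card ≤ ∑ n ∈ G, (L n).card ^ 3 := by
    refine Finset.card_biUnion_le.trans (Finset.sum_le_sum fun n _ => ?_)
    rw [Finset.card_product, Finset.card_product]
    apply le_of_eq; ring
  have hsub : sing m ⊆ ((((G.biUnion (fun n => L n ×ˢ L n ×ˢ L n)) ∪ Z0) ∪ Z1) ∪ Z2) ∪ Z3 := by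
    rintro ⟨u, v, w⟩ ht
    have htT : (u, v, w) ∈ T := (Finset.mem_filter.mp ht).1
    have hd : dot (crs u v) w = 0 := (Finset.mem_filter.mp ht).2
    have hm := htT
    simp only [hT, Finset.mem_product] at hm
    obtain ⟨hu, hv, hw⟩ := hm
    simp only [Finset.mem_union]
    have fin : (∃ n, good m n ∧ dot n u = 0 ∧ dot n v = 0 ∧ dot n w = 0) →
        (u, v, w) ∈ G.biUnion (fun n => L n ×ˢ L n ×ˢ L n) := by
      rintro ⟨n, hn, h1, h2, h3⟩
      simp only [Finset.mem_biUnion, Finset.mem_product, hL, hG, Finset.mem_filter]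
      exact ⟨n, ⟨(good_bd m n hn).1, hn⟩, ⟨hu, h1⟩, ⟨hv, h2⟩, ⟨hw, h3⟩⟩
    by_cases huv : crs u v = 0
    · by_cases huw : crs u w = 0
      · by_cases u1 : u.1 = 0
        · by_cases u2 : u.2.1 = 0
          · by_cases u3 : u.2.2 = 0
            · left; left; left; right
              simp only [hZ0, Finset.mem_product, Finset.mem_singleton]
              exact ⟨Prod.ext u1 (Prod.ext u2 u3), hv, hw⟩
            · right
              exact Finset.mem_filter.mpr ⟨htT, u3, huv, huw⟩
          · left; right
            exact Finset.mem_filter.mpr ⟨htT, u2, huv, huw⟩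
        · left; left; right
          exact Finset.mem_filter.mpr ⟨htT, u1, huv, huw⟩
      · left; left; left; left
        apply fin
        obtain ⟨n, hn, h1, h2, h3⟩ := exists_good m u w v hu hw huw (by
          simp only [dot, crs] at hd ⊢; linear_combination -hd)
        exact ⟨n, hn, h1, h3, h2⟩
    · left; left; left; left
      exact fin (exists_good m u v w hu hv huv hd)
  have h1 := Finset.card_le_card hsub
  have h2 := Finset.card_union_le ((((G.biUnion (fun n => L n ×ˢ L n ×ˢ L n)) ∪ Z0) ∪ Z1) ∪ Z2) Z3
  have h3 := Finset.card_union_le (((G.biUnion (fun n => L n ×ˢ L n ×ˢ L n)) ∪ Z0) ∪ Z1) Z2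
  have h4 := Finset.card_union_le ((G.biUnion (fun n => L n ×ˢ L n ×ˢ L n)) ∪ Z0) Z1
  have h5 := Finset.card_union_le (G.biUnion (fun n => L n ×ˢ L n ×ˢ L n)) Z0
  change (sing m).card ≤ 4 * (2 * m + 1) ^ 6 + ∑ n ∈ G, (L n).card ^ 3
  omega

lemma sing_bound (m : ℕ) (hm : 2 ≤ m) :
    ((sing m).card : ℝ) ≤ (8 * 3 ^ 6 + 130 * 7 ^ 6) * (m : ℝ) ^ 6 * Real.log m := by
  classical
  have hm2 : (2 : ℝ) ≤ m := by exact_mod_cast hm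
  have hm0 : (0 : ℝ) < m := by linarith
  have hlog : 1 ≤ 2 * Real.log m := by
    have h1 := Real.log_le_log (by norm_num) hm2
    have h2 := Real.log_two_gt_d9
    linarith
  have h0 : ((sing m).card : ℝ) ≤ 4 * (2 * m + 1) ^ 6 +
    ∑ n ∈ (cube (2 * m ^ 2)).filter (fun n => good m n),
      (((cube m).filter (fun w => dot n w = 0)).card : ℝ) ^ 3 := by exact_mod_cast sing_card m
  have h1 : ∑ n ∈ (cube (2 * m ^ 2)).filter (fun n => good m n),
      (((cube m).filter (fun w => dot n w = 0)).card : ℝ) ^ 3 ≤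
      ∑ n ∈ (cube (2 * m ^ 2)).filter (fun n => 1 ≤ nrm n),
        (7 * (m:ℝ)) ^ 6 * ((1:ℝ) / (nrm n : ℝ) ^ 3) := by
    refine (Finset.sum_le_sum (g := fun n => (7 * (m:ℝ)) ^ 6 * ((1:ℝ) / (nrm n : ℝ) ^ 3)) ?_).trans
      (Finset.sum_le_sum_of_subset_of_nonneg ?_ ?_)
    · intro n hn
      have hg := (Finset.mem_filter.mp hn).2
      have hc : (((cube m).filter (fun w => dot n w = 0)).card : ℝ) * (nrm n : ℝ) ≤ (6 * m + 1) ^ 2 := by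
        exact_mod_cast good_card m n hg
      have hp : (0:ℝ) < nrm n := by exact_mod_cast (good_bd m n hg).2
      rw [mul_one_div, le_div_iff₀ (by positivity), ← mul_pow]
      calc _ ≤ (((6:ℝ) * m + 1) ^ 2) ^ 3 := by gcongr
        _ ≤ ((7 * (m:ℝ)) ^ 2) ^ 3 := by gcongr; linarith
        _ = _ := by ring
    · intro n hn
      have := Finset.mem_filter.mp hn
      exact Finset.mem_filter.mpr ⟨this.1, (good_bd m n this.2).2⟩
    · intros; positivity
  rw [← Finset.mul_sum] at h1
  have h2 := sum_nrm (2 * m ^ 2)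
  have h3 : Real.log ((2 * m ^ 2 : ℕ) : ℝ) ≤ 3 * Real.log m := by
    have : (3 : ℝ) * Real.log m = Real.log ((m:ℝ) ^ 3) := by rw [Real.log_pow]; norm_num
    rw [this]
    apply Real.log_le_log
    · push_cast; positivity
    · push_cast; nlinarith [sq_nonneg (m:ℝ), mul_nonneg (sq_nonneg (m:ℝ)) (sub_nonneg.mpr hm2)]
  have h4 : ∑ n ∈ (cube (2 * m ^ 2)).filter (fun n => 1 ≤ nrm n), (1 : ℝ) / (nrm n : ℝ) ^ 3
      ≤ 130 * Real.log m := by linarith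
  calc _ ≤ _ := h0
    _ ≤ 4 * (3 * (m:ℝ)) ^ 6 * (2 * Real.log m) + (7 * (m:ℝ)) ^ 6 * (130 * Real.log m) := by
      apply add_le_add
      · calc _ ≤ 4 * (3 * (m:ℝ)) ^ 6 := by gcongr; linarith
          _ ≤ _ := le_mul_of_one_le_right (by positivity) hlog
      · exact h1.trans (by gcongr)
    _ = _ := by ring

def dif (f : Fin 4 → (Fin 3 → ℤ)) (j : Fin 4) : ℤ × ℤ × ℤ :=
  (f j 0 - f 0 0, f j 1 - f 0 1, f j 2 - f 0 2)

lemma det_zero (f : Fin 4 → (Fin 3 → ℤ))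
    (h : Coplanar ℝ (Set.range (fun j => fun i => ((f j i : ℝ))))) :
    dot (crs (dif f 1) (dif f 2)) (dif f 3) = 0 := by
  set P : Fin 4 → (Fin 3 → ℝ) := fun j => fun i => ((f j i : ℝ)) with hP
  by_contra hne
  let A : Matrix (Fin 3) (Fin 3) ℝ := fun k => P k.succ - P 0
  have hdet : A.det ≠ 0 := by
    have : A.det = ((dot (crs (dif f 1) (dif f 2)) (dif f 3) : ℤ) : ℝ) := by
      rw [Matrix.det_fin_three]
      simp only [A, hP, dot, crs, dif, Pi.sub_apply]
      have e1 : (0 : Fin 3).succ = (1 : Fin 4) := rfl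
      have e2 : (1 : Fin 3).succ = (2 : Fin 4) := rfl
      have e3 : (2 : Fin 3).succ = (3 : Fin 4) := rfl
      rw [e1, e2, e3]
      push_cast
      ring
    rw [this]; exact_mod_cast hne
  have hli : LinearIndependent ℝ (fun k : Fin 3 => A k) :=
    Matrix.linearIndependent_rows_of_det_ne_zero hdet
  have hmem : ∀ k, A k ∈ vectorSpan ℝ (Set.range P) := fun k =>
    vsub_mem_vectorSpan ℝ (Set.mem_range_self _) (Set.mem_range_self _)
  have hli2 : LinearIndependent ℝ (fun k : Fin 3 => (⟨A k, hmem k⟩ : vectorSpan ℝ (Set.range P))) := by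
    apply LinearIndependent.of_comp (vectorSpan ℝ (Set.range P)).subtype
    exact hli
  have h3 := hli2.cardinal_le_rank
  have h2 : Module.rank ℝ (vectorSpan ℝ (Set.range P)) ≤ 2 := h
  have h4 := h3.trans h2
  simp only [Cardinal.mk_fin] at h4
  have : (3:ℕ) ≤ 2 := by exact_mod_cast h4
  omega

/-- The number of ordered coplanar 4-tuples of points of `[m]^3` is `O(m^9 log m)`. -/
theorem stmt9 :
    ∃ C : ℝ, 0 < C ∧ ∀ m : ℕ, 2 ≤ m →
      (Nat.card {f : Fin 4 → (Fin 3 → ℤ) //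
          (∀ j i, 0 ≤ f j i ∧ f j i < (m : ℤ)) ∧
          Coplanar ℝ (Set.range (fun j => fun i => ((f j i : ℝ))))} : ℝ)
        ≤ C * (m : ℝ) ^ 9 * Real.log m := by
  refine ⟨27 * (8 * 3 ^ 6 + 130 * 7 ^ 6), by norm_num, fun m hm => ?_⟩
  have hm2 : (2 : ℝ) ≤ m := by exact_mod_cast hm
  have key2 : Nat.card {f : Fin 4 → (Fin 3 → ℤ) //
          (∀ j i, 0 ≤ f j i ∧ f j i < (m : ℤ)) ∧
          Coplanar ℝ (Set.range (fun j => fun i => ((f j i : ℝ))))} ≤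
      Nat.card {x // x ∈ cube m ×ˢ sing m} := by
    refine Nat.card_le_card_of_injective (fun f =>
      ⟨((f.1 0 0, f.1 0 1, f.1 0 2), (dif f.1 1, dif f.1 2, dif f.1 3)), ?_⟩) ?_
    · obtain ⟨f, hb, hc⟩ := f
      have hd : ∀ j, dif f j ∈ cube m := by
        intro j
        rw [mem_cube]
        simp only [dif, abs_le]
        have a0 := hb j 0
        have a1 := hb j 1
        have a2 := hb j 2
        have b0 := hb 0 0
        have b1 := hb 0 1
        have b2 := hb 0 2
        omega
      rw [Finset.mem_product]
      refine ⟨?_, Finset.mem_filter.mpr ⟨?_, det_zero f hc⟩⟩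
      · rw [mem_cube]
        simp only [abs_le]
        have b0 := hb 0 0
        have b1 := hb 0 1
        have b2 := hb 0 2
        omega
      · simp only [Finset.mem_product]
        exact ⟨hd 1, hd 2, hd 3⟩
    · rintro ⟨f, hf⟩ ⟨g, hg⟩ h
      simp only [Subtype.mk.injEq, Prod.mk.injEq, dif] at h
      apply Subtype.ext
      funext j i
      fin_cases j <;> fin_cases i <;> simp <;> omega
  have e : Nat.card {x // x ∈ cube m ×ˢ sing m} = (2 * m + 1) ^ 3 * (sing m).card := by
    rw [Nat.card_eq_fintype_card, Fintype.card_coe, Finset.card_product, card_cube]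
  rw [e] at key2
  have hs := sing_bound m hm
  have hlog : 0 ≤ Real.log m := Real.log_nonneg (by linarith)
  calc _ ≤ (((2 * m + 1) ^ 3 * (sing m).card : ℕ) : ℝ) := by exact_mod_cast key2
    _ = (2 * (m:ℝ) + 1) ^ 3 * (sing m).card := by push_cast; ring
    _ ≤ (3 * (m:ℝ)) ^ 3 * ((8 * 3 ^ 6 + 130 * 7 ^ 6) * (m : ℝ) ^ 6 * Real.log m) := by
      gcongr; linarith
    _ = _ := by ring
end

section
/- There exists an absolute constant C such that for every graph G on n vertices with k edges and every integer m ≥ C((nk)^{1/3} + k^{2/3} (log k)^{1/3}) (with k ≥ 2), there exists a grid-drawing of G in [m]^3: an injective map φ: V(G) → [m]^3 such that (i) for every edge uv and every vertex w ∉ {u,v}, φ(w) does not lie in the interior of the segment [φ(u), φ(v)], and (ii) no two edges' segments share a common interior point. -/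
/-- `φ` is a grid-drawing of the graph `G` in `[m]^3`: vertices go to distinct
points of the grid, no edge contains a non-incident vertex in its interior, and
no two distinct edges share an interior point. -/
def IsGridDrawing {n : ℕ} (m : ℕ) (G : SimpleGraph (Fin n))
    (φ : Fin n → (Fin 3 → ℤ)) : Prop :=
  Function.Injective φ ∧
  (∀ v i, 0 ≤ φ v i ∧ φ v i < (m : ℤ)) ∧
  (∀ u v w, G.Adj u v → w ≠ u → w ≠ v →
    (fun i => ((φ w i : ℝ))) ∉
      openSegment ℝ (fun i => ((φ u i : ℝ))) (fun i => ((φ v i : ℝ)))) ∧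
  (∀ u v u' v', G.Adj u v → G.Adj u' v' → s(u, v) ≠ s(u', v') →
    openSegment ℝ (fun i => ((φ u i : ℝ))) (fun i => ((φ v i : ℝ))) ∩
      openSegment ℝ (fun i => ((φ u' i : ℝ))) (fun i => ((φ v' i : ℝ))) = ∅)


namespace GD

abbrev Z3 := ℤ × ℤ × ℤ

def dot (x y : Z3) : ℤ := x.1 * y.1 + x.2.1 * y.2.1 + x.2.2 * y.2.2

def gram (x y : Z3) : ℤ := dot x x * dot y y - dot x y ^ 2

def crs (x y : Z3) : Z3 :=
  (x.2.1 * y.2.2 - x.2.2 * y.2.1, x.2.2 * y.1 - x.1 * y.2.2, x.1 * y.2.1 - x.2.1 * y.1)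

def dt (x y z : Z3) : ℤ := dot (crs x y) z

/-- integer combination -/
def cmb (i j : ℤ) (x y : Z3) : Z3 :=
  (i * x.1 + j * y.1, i * x.2.1 + j * y.2.1, i * x.2.2 + j * y.2.2)

lemma gram_eq (x y : Z3) : gram x y = dot (crs x y) (crs x y) := by
  simp only [gram, dot, crs]; ring

lemma dot_self_nonneg (x : Z3) : 0 ≤ dot x x := by
  simp only [dot]; nlinarith [mul_self_nonneg x.1, mul_self_nonneg x.2.1, mul_self_nonneg x.2.2]

lemma dot_self_eq_zero {x : Z3} (h : dot x x = 0) : x = 0 := by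
  obtain ⟨a, b, c⟩ := x
  simp only [dot] at h
  have ha : a = 0 := by nlinarith [sq_nonneg a, sq_nonneg b, sq_nonneg c]
  have hb : b = 0 := by nlinarith [sq_nonneg a, sq_nonneg b, sq_nonneg c]
  have hc : c = 0 := by nlinarith [sq_nonneg a, sq_nonneg b, sq_nonneg c]
  subst ha hb hc; rfl

lemma expand (x y z : Z3) :
    cmb (gram x y) 0 z z = cmb 1 (dt x y z)
      (cmb (dot z x * dot y y - dot z y * dot x y) (dot z y * dot x x - dot z x * dot x y) x y)
      (crs x y) := by
  simp only [cmb, gram, dt, dot, crs, Prod.mk.injEq]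
  refine ⟨by ring, by ring, by ring⟩

lemma dt_zero {n x y z : Z3} (hn : n ≠ 0) (hx : dot n x = 0) (hy : dot n y = 0)
    (hz : dot n z = 0) : dt x y z = 0 := by
  obtain ⟨a, b, c⟩ := n
  obtain ⟨x1, x2, x3⟩ := x
  obtain ⟨y1, y2, y3⟩ := y
  obtain ⟨z1, z2, z3⟩ := z
  simp only [dot, dt, crs] at *
  by_contra h
  apply hn
  have ha : a = 0 := by
    refine (mul_eq_zero.1 (?_ : a * _ = 0)).resolve_right h
    linear_combination (y2*z3-y3*z2) * hx + (z2*x3-z3*x2) * hy + (x2*y3-x3*y2)*hz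
  have hb : b = 0 := by
    refine (mul_eq_zero.1 (?_ : b * _ = 0)).resolve_right h
    linear_combination (y3*z1-y1*z3) * hx + (z3*x1-z1*x3) * hy + (x3*y1-x1*y3)*hz
  have hc : c = 0 := by
    refine (mul_eq_zero.1 (?_ : c * _ = 0)).resolve_right h
    linear_combination (y1*z2-y2*z1) * hx + (z1*x2-z2*x1) * hy + (x1*y2-x2*y1)*hz
  simp [ha, hb, hc]

lemma exists_min (S : Set Z3) (hS : S.Nonempty) : ∃ x ∈ S, ∀ y ∈ S, dot x x ≤ dot y y := by
  obtain ⟨x, hx, h⟩ := WellFounded.has_min (measure (fun x : Z3 => (dot x x).toNat)).wf S hS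
  refine ⟨x, hx, fun y hy => ?_⟩
  have := h y hy
  have h1 := dot_self_nonneg x
  have h2 := dot_self_nonneg y
  have h3 : ¬ ((dot y y).toNat < (dot x x).toNat) := this
  omega

lemma exists_round (a d : ℤ) (hd : 0 < d) : ∃ i : ℤ, 4 * (a - i * d) ^ 2 ≤ d ^ 2 := by
  refine ⟨(2 * a + d) / (2 * d), ?_⟩
  have h1 := Int.emod_add_mul_ediv (2 * a + d) (2 * d)
  have h2 := Int.emod_nonneg (2 * a + d) (show 2 * d ≠ 0 by omega)
  have h3 := Int.emod_lt_of_pos (2 * a + d) (show 0 < 2 * d by omega)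
  set q := (2 * a + d) / (2 * d)
  set r := (2 * a + d) % (2 * d)
  have : 2 * (a - q * d) = r - d := by linarith
  have h4 : 4 * (a - q * d) ^ 2 = (r - d) ^ 2 := by rw [← this]; ring
  rw [h4]; apply sq_le_sq'  <;> linarith

set_option maxHeartbeats 1000000 in
theorem reduce (n p q : Z3) (hn : n ≠ 0) (R : ℤ) (hp : dot n p = 0) (hq : dot n q = 0)
    (hpq : gram p q ≠ 0) (hpR : dot p p ≤ R) (hqR : dot q q ≤ R) :
    ∃ e f : Z3, 0 < dot e e ∧ dot e e ≤ dot f f ∧ dot f f ≤ R ∧ |2 * dot e f| ≤ dot e e ∧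
      ∀ x, dot n x = 0 → ∃ i j, x = cmb i j e f ∧ i ^ 2 * dot e e ≤ 2 * dot x x ∧
        j ^ 2 * dot f f ≤ 2 * dot x x := by
  obtain ⟨e, ⟨hen, he0⟩, hemin⟩ := exists_min {x | dot n x = 0 ∧ x ≠ 0}
    ⟨p, hp, by rintro rfl; apply hpq; simp [gram, dot]⟩
  have hepos : 0 < dot e e := lt_of_le_of_ne (dot_self_nonneg e)
    (fun h => he0 (dot_self_eq_zero h.symm))
  have hex : ∃ g, dot n g = 0 ∧ gram e g ≠ 0 ∧ dot g g ≤ R := by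
    by_contra hcon
    push Not at hcon
    have h1 : gram e p = 0 := by
      by_contra h; exact absurd (hcon p hp h) (not_lt.2 hpR)
    have h2 : gram e q = 0 := by
      by_contra h; exact absurd (hcon q hq h) (not_lt.2 hqR)
    -- p and q parallel to e
    apply hpq
    rw [gram_eq] at h1 h2
    have h1 := dot_self_eq_zero h1
    have h2 := dot_self_eq_zero h2
    have key : dot e e * gram p q = 0 := by
      rw [gram_eq]
      obtain ⟨e1, e2, e3⟩ := e
      obtain ⟨p1, p2, p3⟩ := p
      obtain ⟨q1, q2, q3⟩ := q
      simp only [crs, Prod.mk_eq_zero] at h1 h2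
      obtain ⟨a1, a2, a3⟩ := h1
      obtain ⟨b1, b2, b3⟩ := h2
      -- (e·e) (p × q) = ... combination
      have k1 : ∀ i : ℤ, i * i = 0 → i = 0 := fun i h => by simpa using h
      have c1 : (e1*e1+e2*e2+e3*e3) * (p2*q3-p3*q2) = 0 := by
        linear_combination (e1*p1+e2*p2+e3*p3)*b1 + e1 * (q1*a1+q2*a2+q3*a3)
          - (e1*q1+e2*q2+e3*q3)*a1
      have c2 : (e1*e1+e2*e2+e3*e3) * (p3*q1-p1*q3) = 0 := by
        linear_combination (e1*p1+e2*p2+e3*p3)*b2 + e2 * (q1*a1+q2*a2+q3*a3)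
          - (e1*q1+e2*q2+e3*q3)*a2
      have c3 : (e1*e1+e2*e2+e3*e3) * (p1*q2-p2*q1) = 0 := by
        linear_combination (e1*p1+e2*p2+e3*p3)*b3 + e3 * (q1*a1+q2*a2+q3*a3)
          - (e1*q1+e2*q2+e3*q3)*a3
      simp only [dot, crs]
      linear_combination (p2*q3-p3*q2) * c1 + (p3*q1-p1*q3)*c2 + (p1*q2-p2*q1)*c3
    exact (mul_eq_zero.1 key).resolve_left hepos.ne'
  obtain ⟨g, hgn, hgg, hgR⟩ := hex
  obtain ⟨f, ⟨hfn, hfg⟩, hfmin⟩ := exists_min {x | dot n x = 0 ∧ gram e x ≠ 0} ⟨g, hgn, hgg⟩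
  have hf0 : f ≠ 0 := by rintro rfl; apply hfg; simp [gram, dot]
  have hef : dot e e ≤ dot f f := hemin f ⟨hfn, hf0⟩
  have hdn : ∀ i j x y, dot n (cmb i j x y) = i * dot n x + j * dot n y := by
    intros; simp only [dot, cmb]; ring
  have hg1 : ∀ j, gram e (cmb j 1 e f) = gram e f := by
    intros; simp only [gram, dot, cmb]; ring
  have hdd : ∀ i j x y, dot (cmb i j x y) (cmb i j x y) =
      i^2 * dot x x + 2 * i * j * dot x y + j ^ 2 * dot y y := by
    intros; simp only [dot, cmb]; ring
  have m1 := hfmin (cmb 1 1 e f) ⟨by rw [hdn, hen, hfn]; ring, by rw [hg1]; exact hfg⟩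
  have m2 := hfmin (cmb (-1) 1 e f) ⟨by rw [hdn, hen, hfn]; ring, by rw [hg1]; exact hfg⟩
  rw [hdd] at m1 m2
  have hdot : |2 * dot e f| ≤ dot e e := abs_le.2 ⟨by linarith, by linarith⟩
  refine ⟨e, f, hepos, hef, (hfmin g ⟨hgn, hgg⟩).trans hgR, hdot, ?_⟩
  have hD : 0 < gram e f := by
    refine lt_of_le_of_ne ?_ (Ne.symm hfg)
    rw [gram_eq]; exact dot_self_nonneg _
  -- quadratic form bounds
  have hab := abs_le.1 hdot
  have hlow : ∀ i j : ℤ, i^2 * dot e e + j^2 * dot f f ≤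
      2 * (i^2 * dot e e + 2 * i * j * dot e f + j ^ 2 * dot f f) := by
    intro i j
    have h1 : |4 * i * j * dot e f| ≤ 2 * |i| * |j| * dot e e := by
      have : 4 * i * j * dot e f = 2 * i * j * (2 * dot e f) := by ring
      rw [this, abs_mul, abs_mul, abs_mul]
      have : |(2:ℤ)| = 2 := rfl
      rw [this]
      exact mul_le_mul_of_nonneg_left hdot (by positivity)
    have h2 := (abs_le.1 h1).1
    nlinarith [sq_nonneg (|i| - |j|), sq_abs i, sq_abs j, mul_nonneg (sq_nonneg j) (sub_nonneg.2 hef),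
      mul_nonneg (sq_nonneg (|i| - |j|)) hepos.le]
  intro x hx
  have hexp := expand e f x
  rw [dt_zero hn hen hfn hx] at hexp
  obtain ⟨D, hDdef⟩ : ∃ D, D = gram e f := ⟨_, rfl⟩
  rw [← hDdef] at hD hexp
  generalize dot x e * dot f f - dot x f * dot e f = A at hexp
  generalize dot x f * dot e e - dot x e * dot e f = B at hexp
  obtain ⟨i, hi⟩ := exists_round A D hD
  obtain ⟨j, hj⟩ := exists_round B D hD
  have hxy : x = cmb i j e f := by
    obtain ⟨y, hy⟩ : ∃ y, y = cmb 1 (-1) x (cmb i j e f) := ⟨_, rfl⟩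
    have hyn : dot n y = 0 := by rw [hy, hdn, hdn, hen, hfn, hx]; ring
    have hDy : cmb D 0 y y = cmb (A - i * D) (B - j * D) e f := by
      simp only [cmb, Prod.mk.injEq] at hexp
      obtain ⟨h1, h2, h3⟩ := hexp
      simp only [hy, cmb, Prod.mk.injEq]
      refine ⟨by linear_combination h1, by linear_combination h2, by linear_combination h3⟩
    generalize A - i * D = a at hi hDy
    generalize B - j * D = b at hj hDy
    have hny : D^2 * dot y y = a^2 * dot e e + 2 * a * b * dot e f + b ^ 2 * dot f f := by
      rw [← hdd, ← hDy, hdd]; ring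
    have h2ab : 2 * a * b * dot e f * 4 ≤ D^2 * dot e e := by
      have h4 : 4 * |a| * |b| ≤ D^2 := by
        nlinarith [sq_nonneg (|a| - |b|), sq_abs a, sq_abs b]
      have : 2 * a * b * dot e f * 4 ≤ |2 * a * b * dot e f * 4| := le_abs_self _
      have h5 : |2 * a * b * dot e f * 4| = (4 * |a| * |b|) * |2 * dot e f| := by
        simp only [abs_mul]; norm_num; ring
      rw [h5] at this
      exact this.trans (mul_le_mul h4 hdot (abs_nonneg _) (by positivity))
    have hDsq : 0 < D^2 := by positivity
    have hylt : dot y y < dot f f := by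
      have : D^2 * (4 * dot y y) ≤ D^2 * (3 * dot f f) := by
        nlinarith [mul_le_mul_of_nonneg_right hi hepos.le,
          mul_le_mul_of_nonneg_right hj (hepos.le.trans hef),
          mul_le_mul_of_nonneg_left hef hDsq.le]
      have := le_of_mul_le_mul_left this hDsq
      linarith
    have hgy : gram e y = 0 := by
      by_contra h
      exact absurd (hfmin y ⟨hyn, h⟩) (not_le.2 hylt)
    have hb0 : b = 0 := by
      have : D^2 * gram e y = b^2 * D := by
        have h1 : D^2 * gram e y = gram e (cmb D 0 y y) := by
          simp only [gram, dot, cmb]; ring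
        rw [h1, hDy, hDdef]; simp only [gram, dot, cmb]; ring
      rw [hgy, mul_zero] at this
      have := (mul_eq_zero.1 this.symm).resolve_right hD.ne'
      exact pow_eq_zero_iff (two_ne_zero) |>.1 this
    have hy0 : y = 0 := by
      by_contra h
      have h1 := hemin y ⟨hyn, h⟩
      rw [hb0] at hny
      have : D^2 * (4 * dot y y) ≤ D^2 * dot e e := by
        nlinarith [mul_le_mul_of_nonneg_right hi hepos.le]
      have := le_of_mul_le_mul_left this hDsq
      linarith
    rw [hy] at hy0
    simp only [cmb, Prod.mk_eq_zero] at hy0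
    obtain ⟨h1, h2, h3⟩ := hy0
    obtain ⟨x1, x2, x3⟩ := x
    simp only [cmb, Prod.mk.injEq]
    refine ⟨by linarith, by linarith, by linarith⟩
  refine ⟨i, j, hxy, ?_, ?_⟩
  · have := hlow i j
    rw [← hdd, ← hxy] at this
    have := mul_nonneg (sq_nonneg j) (hepos.le.trans hef)
    linarith
  · have := hlow i j
    rw [← hdd, ← hxy] at this
    have := mul_nonneg (sq_nonneg i) (hepos.le)
    linarith

noncomputable def bx (N : ℤ) : Finset Z3 := Finset.Icc (-N) N ×ˢ Finset.Icc (-N) N ×ˢ Finset.Icc (-N) N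

lemma mem_bx {N : ℤ} {x : Z3} : x ∈ bx N ↔ |x.1| ≤ N ∧ |x.2.1| ≤ N ∧ |x.2.2| ≤ N := by
  simp [bx, abs_le]

lemma dot_le_of_mem {N : ℤ} {x : Z3} (h : x ∈ bx N) : dot x x ≤ 3 * N ^ 2 := by
  rw [mem_bx] at h
  obtain ⟨h1, h2, h3⟩ := h
  have := sq_le_sq' (abs_le.1 h1).1 (abs_le.1 h1).2
  have := sq_le_sq' (abs_le.1 h2).1 (abs_le.1 h2).2
  have := sq_le_sq' (abs_le.1 h3).1 (abs_le.1 h3).2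
  simp only [dot]; nlinarith

lemma gram_ne {x y : Z3} (h : crs x y ≠ 0) : gram x y ≠ 0 := by
  rw [gram_eq]; exact fun h' => h (dot_self_eq_zero h')

lemma exists_plane_aux {m : ℤ} (hm : 1 ≤ m) {u v w p : Z3} (hp : p ∈ bx m) (hp0 : p ≠ 0)
    (hu : crs p u = 0) (hv : crs p v = 0) (hw : crs p w = 0) :
    ∃ n p q : Z3, n ≠ 0 ∧ p ∈ bx m ∧ q ∈ bx m ∧ dot n p = 0 ∧ dot n q = 0 ∧ gram p q ≠ 0 ∧
      dot n u = 0 ∧ dot n v = 0 ∧ dot n w = 0 := by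
  have key : ∀ q x : Z3, crs p x = 0 → dot (crs p q) x = 0 := by
    intro q x h
    have : dot (crs p q) x = - dot (crs p x) q := by simp only [dot, crs]; ring
    rw [this, h]; simp [dot]
  have k1 : ∀ q : Z3, dot (crs p q) q = 0 := by intro q; simp only [dot, crs]; ring
  have k2 : ∀ q : Z3, dot (crs p q) p = 0 := by intro q; simp only [dot, crs]; ring
  have hq : ∃ q ∈ bx m, crs p q ≠ 0 := by
    by_cases h : p.1 = 0 ∧ p.2.1 = 0
    · refine ⟨(1, 0, 0), by simp [mem_bx]; omega, ?_⟩
      obtain ⟨a, b, c⟩ := p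
      obtain ⟨h1, h2⟩ := h
      simp only at h1 h2
      subst h1 h2
      have : c ≠ 0 := by rintro rfl; exact hp0 rfl
      simp [crs, this]
    · refine ⟨(0, 0, 1), by simp [mem_bx]; omega, ?_⟩
      intro h'
      simp [crs] at h'
      exact h ⟨h'.2, h'.1⟩
  obtain ⟨q, hq, hqp⟩ := hq
  exact ⟨crs p q, p, q, hqp, hp, hq, k2 q, k1 q, gram_ne hqp, key _ _ hu, key _ _ hv, key _ _ hw⟩

lemma exists_plane {m : ℤ} (hm : 1 ≤ m) {u v w : Z3} (hu : u ∈ bx m) (hv : v ∈ bx m)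
    (hw : w ∈ bx m) (hd : dt u v w = 0) :
    ∃ n p q : Z3, n ≠ 0 ∧ p ∈ bx m ∧ q ∈ bx m ∧ dot n p = 0 ∧ dot n q = 0 ∧ gram p q ≠ 0 ∧
      dot n u = 0 ∧ dot n v = 0 ∧ dot n w = 0 := by
  have k1 : ∀ p q : Z3, dot (crs p q) q = 0 := by intro p q; simp only [dot, crs]; ring
  have k2 : ∀ p q : Z3, dot (crs p q) p = 0 := by intro p q; simp only [dot, crs]; ring
  by_cases h1 : crs u v = 0
  swap
  · exact ⟨crs u v, u, v, h1, hu, hv, k2 _ _, k1 _ _, gram_ne h1, k2 _ _, k1 _ _, hd⟩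
  by_cases h2 : crs u w = 0
  swap
  · refine ⟨crs u w, u, w, h2, hu, hw, k2 _ _, k1 _ _, gram_ne h2, k2 _ _, ?_, k1 _ _⟩
    have : dot (crs u w) v = - dt u v w := by simp only [dt, dot, crs]; ring
    rw [this, hd, neg_zero]
  by_cases h3 : crs v w = 0
  swap
  · refine ⟨crs v w, v, w, h3, hv, hw, k2 _ _, k1 _ _, gram_ne h3, ?_, k2 _ _, k1 _ _⟩
    have : dot (crs v w) u = dt u v w := by simp only [dt, dot, crs]; ring
    rw [this, hd]
  have k0 : ∀ p, crs p p = 0 := by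
    intro p; simp only [crs, Prod.mk_eq_zero]; refine ⟨by ring, by ring, by ring⟩
  by_cases u0 : u = 0
  swap
  · exact exists_plane_aux hm hu u0 (k0 _) h1 h2
  by_cases v0 : v = 0
  swap
  · exact exists_plane_aux hm hv v0 (by rw [u0]; simp [crs]) (k0 _) h3
  by_cases w0 : w = 0
  swap
  · exact exists_plane_aux hm hw w0 (by rw [u0]; simp [crs]) (by rw [v0]; simp [crs]) (k0 _)
  subst u0 v0 w0
  exact exists_plane_aux hm (p := (1, 0, 0)) (by simp [mem_bx]; omega) (by simp)
    (by simp [crs]) (by simp [crs]) (by simp [crs])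

/-- the triples of coplanar vectors in the box -/
noncomputable def T (m : ℤ) : Finset (Z3 × Z3 × Z3) :=
  (bx m ×ˢ bx m ×ˢ bx m).filter (fun t => dt t.1 t.2.1 t.2.2 = 0)

def tt (e f : Z3) : ℤ := max (max |f.1| |f.2.1|) |e.2.2|

/-- admissible reduced pairs whose first vector has largest entry in the last coordinate -/
noncomputable def E (m : ℤ) : Finset (Z3 × Z3) :=
  (bx (2 * m) ×ˢ bx (2 * m)).filter (fun t => t.1.2.2 ≠ 0 ∧ |t.1.1| ≤ |t.1.2.2| ∧
    |t.1.2.1| ≤ |t.1.2.2| ∧ |2 * dot t.1 t.2| ≤ dot t.1 t.1)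

noncomputable def P (m : ℤ) (e f : Z3) : Finset (ℤ × ℤ) :=
  Finset.Icc (-(3 * m / |e.2.2|)) (3 * m / |e.2.2|) ×ˢ Finset.Icc (-(3 * m / tt e f)) (3 * m / tt e f)

def cmb3 (e f : Z3) (t : (ℤ × ℤ) × (ℤ × ℤ) × (ℤ × ℤ)) : Z3 × Z3 × Z3 :=
  (cmb t.1.1 t.1.2 e f, cmb t.2.1.1 t.2.1.2 e f, cmb t.2.2.1 t.2.2.2 e f)

noncomputable def Tz (m : ℤ) : Finset (Z3 × Z3 × Z3) :=
  (E m).biUnion fun t => (P m t.1 t.2 ×ˢ P m t.1 t.2 ×ˢ P m t.1 t.2).image (cmb3 t.1 t.2)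

def Rep (m : ℤ) (e f x : Z3) : Prop :=
  ∃ i j, x = cmb i j e f ∧ i ^ 2 * dot e e ≤ 6 * m ^ 2 ∧ j ^ 2 * dot f f ≤ 6 * m ^ 2

lemma mem_P {m : ℤ} (hm : 1 ≤ m) {e f : Z3} (he : 0 < |e.2.2|) (hef : dot e e ≤ dot f f) {i j : ℤ}
    (hi : i ^ 2 * dot e e ≤ 6 * m ^ 2) (hj : j ^ 2 * dot f f ≤ 6 * m ^ 2) : (i, j) ∈ P m e f := by
  have aux : ∀ i s d : ℤ, i ^ 2 * d ≤ 6 * m ^ 2 → s ^ 2 ≤ d → |i| * |s| ≤ 3 * m := by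
    intro i s d h1 h2
    rw [← abs_mul]
    apply abs_le_of_sq_le_sq _ (by omega)
    have := mul_le_mul_of_nonneg_left h2 (sq_nonneg i)
    nlinarith
  have he2 : e.2.2 ^ 2 ≤ dot e e := by simp only [dot]; nlinarith [sq_nonneg e.1, sq_nonneg e.2.1]
  have hf1 : f.1 ^ 2 ≤ dot f f := by simp only [dot]; nlinarith [sq_nonneg f.2.2, sq_nonneg f.2.1]
  have hf2 : f.2.1 ^ 2 ≤ dot f f := by simp only [dot]; nlinarith [sq_nonneg f.2.2, sq_nonneg f.1]
  have ht : 0 < tt e f := lt_of_lt_of_le he (le_max_right _ _)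
  have h1 : |i| ≤ 3 * m / |e.2.2| := (Int.le_ediv_iff_mul_le he).2 (aux _ _ _ hi he2)
  have h2 : |j| ≤ 3 * m / tt e f := by
    rw [Int.le_ediv_iff_mul_le ht]
    unfold tt
    rcases max_choice (max |f.1| |f.2.1|) |e.2.2| with h | h <;> rw [h]
    · rcases max_choice |f.1| |f.2.1| with h | h <;> rw [h]
      · exact aux _ _ _ hj hf1
      · exact aux _ _ _ hj hf2
    · exact aux _ _ _ hj (he2.trans hef)
  simp only [P, Finset.mem_product, Finset.mem_Icc]
  exact ⟨abs_le.1 h1, abs_le.1 h2⟩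

lemma mem_Tz {m : ℤ} (hm : 1 ≤ m) {e f u v w : Z3} (he : 0 < dot e e) (hef : dot e e ≤ dot f f)
    (hf : dot f f ≤ 3 * m ^ 2) (hd : |2 * dot e f| ≤ dot e e) (h1 : |e.1| ≤ |e.2.2|)
    (h2 : |e.2.1| ≤ |e.2.2|) (hu : Rep m e f u) (hv : Rep m e f v) (hw : Rep m e f w) :
    (u, v, w) ∈ Tz m := by
  have hz : e.2.2 ≠ 0 := by
    intro h
    rw [h] at h1 h2
    simp at h1 h2
    simp [dot, h, h1, h2] at he
  have hz' : 0 < |e.2.2| := abs_pos.2 hz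
  have hbx : ∀ x : Z3, dot x x ≤ 3 * m ^ 2 → x ∈ bx (2 * m) := by
    intro x hx
    rw [mem_bx]
    simp only [dot] at hx
    refine ⟨?_, ?_, ?_⟩ <;> apply abs_le_of_sq_le_sq _ (by omega) <;>
      nlinarith [sq_nonneg x.1, sq_nonneg x.2.1, sq_nonneg x.2.2, sq_nonneg m]
  obtain ⟨i1, j1, rfl, a1, b1⟩ := hu
  obtain ⟨i2, j2, rfl, a2, b2⟩ := hv
  obtain ⟨i3, j3, rfl, a3, b3⟩ := hw
  simp only [Tz, Finset.mem_biUnion, Finset.mem_image]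
  refine ⟨(e, f), ?_, ((i1, j1), (i2, j2), (i3, j3)), ?_, rfl⟩
  · simp only [E, Finset.mem_filter, Finset.mem_product]
    exact ⟨⟨hbx e (hef.trans hf), hbx f hf⟩, hz, h1, h2, hd⟩
  · simp only [Finset.mem_product]
    exact ⟨mem_P hm hz' hef a1 b1, mem_P hm hz' hef a2 b2, mem_P hm hz' hef a3 b3⟩

def rot (x : Z3) : Z3 := (x.2.1, x.2.2, x.1)

def rot3 (t : Z3 × Z3 × Z3) : Z3 × Z3 × Z3 := (rot t.1, rot t.2.1, rot t.2.2)

lemma dot_rot (x y : Z3) : dot (rot x) (rot y) = dot x y := by simp only [dot, rot]; ring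

lemma Rep.rot {m : ℤ} {e f x : Z3} (h : Rep m e f x) : Rep m (rot e) (rot f) (rot x) := by
  obtain ⟨i, j, rfl, h1, h2⟩ := h
  exact ⟨i, j, rfl, by rwa [dot_rot], by rwa [dot_rot]⟩

lemma T_subset {m : ℤ} (hm : 1 ≤ m) :
    T m ⊆ Tz m ∪ ((Tz m).image rot3 ∪ (Tz m).image (rot3 ∘ rot3)) := by
  rintro ⟨u, v, w⟩ h
  simp only [T, Finset.mem_filter, Finset.mem_product] at h
  obtain ⟨⟨hu, hv, hw⟩, hd⟩ := h
  obtain ⟨n, p, q, hn, hp, hq, hnp, hnq, hg, nu, nv, nw⟩ := exists_plane hm hu hv hw hd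
  obtain ⟨e, f, he, hef, hf, hdot, hrep⟩ := reduce n p q hn (3 * m ^ 2) hnp hnq hg
    (dot_le_of_mem hp) (dot_le_of_mem hq)
  have rep : ∀ x, x ∈ bx m → dot n x = 0 → Rep m e f x := by
    intro x hx hnx
    obtain ⟨i, j, h1, h2, h3⟩ := hrep x hnx
    have := dot_le_of_mem hx
    exact ⟨i, j, h1, by linarith, by linarith⟩
  have ru := rep u hu nu
  have rv := rep v hv nv
  have rw' := rep w hw nw
  simp only [Finset.mem_union, Finset.mem_image]
  by_cases hz : |e.1| ≤ |e.2.2| ∧ |e.2.1| ≤ |e.2.2|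
  · left
    exact mem_Tz hm he hef hf hdot hz.1 hz.2 ru rv rw'
  by_cases hx : |e.2.1| ≤ |e.1| ∧ |e.2.2| ≤ |e.1|
  · right; right
    refine ⟨rot3 (u, v, w), mem_Tz hm (e := rot e) (f := rot f) ?_ ?_ ?_ ?_ hx.1 hx.2
      ru.rot rv.rot rw'.rot, rfl⟩ <;> simpa only [dot_rot]
  · right; left
    have hy : |e.2.2| ≤ |e.2.1| ∧ |e.1| ≤ |e.2.1| := by omega
    refine ⟨rot3 (rot3 (u, v, w)), mem_Tz hm (e := rot (rot e)) (f := rot (rot f)) ?_ ?_ ?_ ?_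
      hy.1 hy.2 ru.rot.rot rv.rot.rot rw'.rot.rot, rfl⟩ <;> simpa only [dot_rot]

lemma card_T_le {m : ℤ} (hm : 1 ≤ m) : (T m).card ≤ 3 * (Tz m).card := by
  have h1 := Finset.card_le_card (T_subset hm)
  have h2 := Finset.card_union_le (Tz m) ((Tz m).image rot3 ∪ (Tz m).image (rot3 ∘ rot3))
  have h3 := Finset.card_union_le ((Tz m).image rot3) ((Tz m).image (rot3 ∘ rot3))
  have h4 : ((Tz m).image rot3).card ≤ _ := Finset.card_image_le
  have h5 : ((Tz m).image (rot3 ∘ rot3)).card ≤ _ := Finset.card_image_le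
  omega

lemma card_Icc_mul {m s : ℤ} (hs : 0 < s) (hm : 1 ≤ m) (hsm : s ≤ 2 * m) :
    ((Finset.Icc (-(3 * m / s)) (3 * m / s)).card : ℤ) * s ≤ 8 * m := by
  have h0 : 0 ≤ 3 * m / s := Int.ediv_nonneg (by omega) hs.le
  rw [Int.card_Icc, Int.toNat_of_nonneg (by omega)]
  have := Int.ediv_mul_le (3 * m) hs.ne'
  nlinarith

lemma tt_pos {m : ℤ} {t : Z3 × Z3} (h : t ∈ E m) :
    0 < |t.1.2.2| ∧ |t.1.2.2| ≤ 2 * m ∧ 0 < tt t.1 t.2 ∧ tt t.1 t.2 ≤ 2 * m := by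
  simp only [E, Finset.mem_filter, Finset.mem_product, mem_bx] at h
  obtain ⟨⟨⟨a1, a2, a3⟩, b1, b2, b3⟩, h1, -, -, -⟩ := h
  refine ⟨abs_pos.2 h1, a3, lt_of_lt_of_le (abs_pos.2 h1) (le_max_right _ _), ?_⟩
  exact max_le (max_le b1 b2) a3

lemma card_P_le {m : ℤ} (hm : 1 ≤ m) {t : Z3 × Z3} (h : t ∈ E m) :
    ((P m t.1 t.2).card : ℝ) ^ 3 ≤ 64 ^ 3 * (m : ℝ) ^ 6 *
      (1 / (|t.1.2.2| : ℤ) ^ 3 * (1 / (tt t.1 t.2 : ℝ) ^ 3)) := by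
  obtain ⟨h1, h2, h3, h4⟩ := tt_pos h
  have e1 := card_Icc_mul h1 hm h2
  have e2 := card_Icc_mul h3 hm h4
  have hP : ((P m t.1 t.2).card : ℤ) * (|t.1.2.2| * tt t.1 t.2) ≤ 64 * m ^ 2 := by
    rw [P, Finset.card_product]
    push_cast
    calc _ = _ := mul_mul_mul_comm _ _ _ _
      _ ≤ (8 * m) * (8 * m) := mul_le_mul e1 e2 (by positivity) (by omega)
      _ = _ := by ring
  have hP' : ((P m t.1 t.2).card : ℝ) * (((|t.1.2.2| : ℤ) : ℝ) * tt t.1 t.2) ≤ 64 * (m : ℝ) ^ 2 := by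
    exact_mod_cast hP
  have h1' : (0 : ℝ) < ((|t.1.2.2| : ℤ) : ℝ) := by exact_mod_cast h1
  have h3' : (0 : ℝ) < tt t.1 t.2 := by exact_mod_cast h3
  have := pow_le_pow_left₀ (by positivity) hP' 3
  generalize ((|t.1.2.2| : ℤ) : ℝ) = s at *
  rw [one_div_mul_one_div, mul_one_div, le_div_iff₀ (by positivity)]
  calc _ = _ := by ring
    _ ≤ _ := this
    _ = _ := by ring

lemma card_Tz_le {m : ℤ} (hm : 1 ≤ m) : ((Tz m).card : ℝ) ≤ 64 ^ 3 * (m : ℝ) ^ 6 *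
    ∑ t ∈ E m, (1 / ((|t.1.2.2| : ℤ) : ℝ) ^ 3 * (1 / (tt t.1 t.2 : ℝ) ^ 3)) := by
  have h1 : (Tz m).card ≤ ∑ t ∈ E m, (P m t.1 t.2).card ^ 3 := by
    refine Finset.card_biUnion_le.trans (Finset.sum_le_sum fun t _ => ?_)
    refine Finset.card_image_le.trans (le_of_eq ?_)
    rw [Finset.card_product, Finset.card_product]; ring
  calc ((Tz m).card : ℝ) ≤ ((∑ t ∈ E m, (P m t.1 t.2).card ^ 3 : ℕ) : ℝ) := by exact_mod_cast h1
    _ = ∑ t ∈ E m, ((P m t.1 t.2).card : ℝ) ^ 3 := by push_cast; rfl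
    _ ≤ _ := by
      rw [Finset.mul_sum]
      exact Finset.sum_le_sum fun t ht => card_P_le hm ht

lemma sum_sym_le (g : ℤ → ℝ) (h0 : 0 ≤ g 0) (N : ℕ) :
    ∑ y ∈ Finset.Icc (-(N : ℤ)) N, g |y| ≤ 2 * ∑ k ∈ Finset.range (N + 1), g k := by
  induction N with
  | zero => simp; linarith
  | succ N ih =>
    have : Finset.Icc (-((N + 1 : ℕ) : ℤ)) ((N + 1 : ℕ) : ℤ) =
        insert ((N + 1 : ℕ) : ℤ) (insert (-((N + 1 : ℕ) : ℤ)) (Finset.Icc (-(N : ℤ)) N)) := by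
      ext x; simp only [Finset.mem_Icc, Finset.mem_insert]; omega
    rw [this, Finset.sum_insert, Finset.sum_insert, Finset.sum_range_succ, abs_neg,
      abs_of_nonneg (by omega : (0:ℤ) ≤ ((N + 1 : ℕ) : ℤ))]
    · linarith
    · simp only [Finset.mem_Icc]; omega
    · simp only [Finset.mem_Icc, Finset.mem_insert]; omega

lemma sum_range_le (t : ℝ) (ht : 1 ≤ t) (M : ℕ) :
    ∑ k ∈ Finset.range M, 1 / ((k : ℝ) + t) ^ 2 ≤ 2 / t - 2 / (M + t) := by
  induction M with
  | zero => simp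
  | succ M ih =>
    rw [Finset.sum_range_succ]
    have hM : (0 : ℝ) ≤ M := by positivity
    have hx : 1 ≤ (M : ℝ) + t := by linarith
    have : 1 / ((M : ℝ) + t) ^ 2 ≤ 2 / (M + t) - 2 / ((M + 1 : ℕ) + t) := by
      push_cast
      rw [show (M : ℝ) + 1 + t = (M + t) + 1 by ring]
      generalize (M : ℝ) + t = x at hx
      rw [div_sub_div _ _ (by linarith) (by linarith), div_le_div_iff₀ (by positivity) (by nlinarith)]
      nlinarith
    linarith

lemma sum_max_sq (t : ℤ) (ht : 1 ≤ t) (N : ℕ) :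
    ∑ y ∈ Finset.Icc (-(N : ℤ)) N, 1 / ((max |y| t : ℤ) : ℝ) ^ 2 ≤ 16 / (t : ℝ) := by
  have ht' : (1 : ℝ) ≤ t := by exact_mod_cast ht
  refine (sum_sym_le (fun y => 1 / ((max y t : ℤ) : ℝ) ^ 2) (by positivity) N).trans ?_
  have h1 : ∀ k ∈ Finset.range (N + 1), 1 / ((max (k : ℤ) t : ℤ) : ℝ) ^ 2 ≤
      4 * (1 / ((k : ℝ) + t) ^ 2) := by
    intro k _
    have hk : (0 : ℝ) ≤ k := by positivity
    push_cast
    have hm1 : (k : ℝ) ≤ max (k : ℝ) t := le_max_left _ _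
    have hm2 : (t : ℝ) ≤ max (k : ℝ) t := le_max_right _ _
    rw [mul_one_div, div_le_div_iff₀ (by positivity) (by positivity)]
    nlinarith
  have h2 := Finset.sum_le_sum h1
  rw [← Finset.mul_sum] at h2
  have h3 := sum_range_le t ht' (N + 1)
  have h4 : 0 ≤ 2 / (((N + 1 : ℕ) : ℝ) + t) := by positivity
  have h5 : (16 : ℝ) / t = 8 * (2 / t) := by ring
  rw [h5]
  linarith

lemma sum_max_cube (t : ℤ) (ht : 1 ≤ t) (N : ℕ) :
    ∑ y ∈ Finset.Icc (-(N : ℤ)) N, 1 / ((max |y| t : ℤ) : ℝ) ^ 3 ≤ 16 / (t : ℝ) ^ 2 := by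
  have ht' : (1 : ℝ) ≤ t := by exact_mod_cast ht
  have h := sum_max_sq t ht N
  calc _ ≤ ∑ y ∈ Finset.Icc (-(N : ℤ)) N, (1 / (t : ℝ)) * (1 / ((max |y| t : ℤ) : ℝ) ^ 2) := by
        refine Finset.sum_le_sum fun y _ => ?_
        have h1 : (t : ℝ) ≤ ((max |y| t : ℤ) : ℝ) := by exact_mod_cast le_max_right _ _
        generalize ((max |y| t : ℤ) : ℝ) = x at h1
        have hx : 0 < x := by linarith
        rw [one_div_mul_one_div]
        apply one_div_le_one_div_of_le (by positivity)
        have := mul_le_mul_of_nonneg_right h1 (sq_nonneg x)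
        linarith [this, (by ring : x ^ 3 = x * x ^ 2)]
    _ ≤ (1 / (t : ℝ)) * (16 / t) := by
        rw [← Finset.mul_sum]; exact mul_le_mul_of_nonneg_left h (by positivity)
    _ = _ := by field_simp

lemma sum_max_two (t : ℤ) (ht : 1 ≤ t) (N : ℕ) :
    ∑ x ∈ Finset.Icc (-(N : ℤ)) N, ∑ y ∈ Finset.Icc (-(N : ℤ)) N,
      1 / ((max (max |x| |y|) t : ℤ) : ℝ) ^ 3 ≤ 256 / (t : ℝ) := by
  calc _ ≤ ∑ x ∈ Finset.Icc (-(N : ℤ)) N, 16 * (1 / ((max |x| t : ℤ) : ℝ) ^ 2) := by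
        refine Finset.sum_le_sum fun x _ => ?_
        have := sum_max_cube (max |x| t) (ht.trans (le_max_right _ _)) N
        rw [mul_one_div]
        refine le_trans (le_of_eq ?_) this
        refine Finset.sum_congr rfl fun y _ => ?_
        rw [max_comm |x| |y|, max_assoc]
    _ ≤ 16 * (16 / (t : ℝ)) := by
        rw [← Finset.mul_sum]; exact mul_le_mul_of_nonneg_left (sum_max_sq t ht N) (by norm_num)
    _ = _ := by ring

lemma card_slab (r c N : ℤ) (hr : r ≠ 0) :
    (((Finset.Icc (-N) N).filter (fun z => |2 * (c + r * z)| ≤ 3 * r ^ 2)).card : ℤ) ≤ 7 * |r| := by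
  have hs : 0 < |r| := abs_pos.2 hr
  obtain ⟨d, hd⟩ : ∃ d : ℤ, ∀ z, |2 * (c + r * z)| = |2 * (d + |r| * z)| := by
    rcases abs_choice r with h | h
    · exact ⟨c, fun z => by rw [h]⟩
    · exact ⟨-c, fun z => by rw [h, ← abs_neg]; congr 1; ring⟩
  have hsub : (Finset.Icc (-N) N).filter (fun z => |2 * (c + r * z)| ≤ 3 * r ^ 2) ⊆
      Finset.Icc (-(d / |r|) - 2 * |r| - 1) (-(d / |r|) + 2 * |r| + 1) := by
    intro z hz
    rw [Finset.mem_filter, hd, ← sq_abs r] at hz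
    have h1 := abs_le.1 hz.2
    generalize |r| = s at *
    have h2 := Int.emod_add_mul_ediv d s
    have h3 := Int.emod_nonneg d hs.ne'
    have h4 := Int.emod_lt_of_pos d hs
    generalize d / s = q at *
    generalize d % s = ρ at *
    rw [Finset.mem_Icc]
    have u1 : s * (z + q) < s * (2 * s + 2) := by nlinarith
    have u2 : s * (-(2 * s + 2)) < s * (z + q) := by nlinarith
    have u1 := lt_of_mul_lt_mul_left u1 hs.le
    have u2 := lt_of_mul_lt_mul_left u2 hs.le
    constructor <;> linarith
  have := Finset.card_le_card hsub
  rw [Int.card_Icc] at this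
  omega

lemma inner_sum (N : ℕ) (e : Z3) (h0 : e.2.2 ≠ 0) (h1 : |e.1| ≤ |e.2.2|) (h2 : |e.2.1| ≤ |e.2.2|) :
    ∑ f ∈ (bx N).filter (fun f => |2 * dot e f| ≤ dot e e), 1 / (tt e f : ℝ) ^ 3 ≤ 1792 := by
  have hs : 0 < |e.2.2| := abs_pos.2 h0
  have hs' : (0 : ℝ) < ((|e.2.2| : ℤ) : ℝ) := by exact_mod_cast hs
  rw [Finset.sum_filter, bx, Finset.sum_product]
  simp_rw [Finset.sum_product]
  have hee : dot e e ≤ 3 * e.2.2 ^ 2 := by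
    have := sq_le_sq.2 h1
    have := sq_le_sq.2 h2
    simp only [dot]; nlinarith
  calc _ ≤ ∑ x ∈ Finset.Icc (-(N : ℤ)) N, ∑ y ∈ Finset.Icc (-(N : ℤ)) N,
      (7 * ((|e.2.2| : ℤ) : ℝ)) * (1 / ((max (max |x| |y|) |e.2.2| : ℤ) : ℝ) ^ 3) := by
        refine Finset.sum_le_sum fun x _ => Finset.sum_le_sum fun y _ => ?_
        simp only [tt]
        rw [← Finset.sum_filter, Finset.sum_const, nsmul_eq_mul]
        refine mul_le_mul_of_nonneg_right ?_ ?_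
        · have hc := card_slab e.2.2 (e.1 * x + e.2.1 * y) N h0
          have hsub : (Finset.Icc (-(N : ℤ)) N).filter (fun z => |2 * dot e (x, y, z)| ≤ dot e e) ⊆
            (Finset.Icc (-(N : ℤ)) N).filter
              (fun z => |2 * (e.1 * x + e.2.1 * y + e.2.2 * z)| ≤ 3 * e.2.2 ^ 2) := by
            intro z hz
            simp only [Finset.mem_filter] at hz ⊢
            exact ⟨hz.1, hz.2.trans hee⟩
          have hcc := Finset.card_le_card hsub
          have : (((Finset.Icc (-(N : ℤ)) N).filter
            (fun z => |2 * dot e (x, y, z)| ≤ dot e e)).card : ℤ) ≤ 7 * |e.2.2| := by omega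
          exact_mod_cast this
        · have : (0 : ℝ) ≤ ((max (max |x| |y|) |e.2.2| : ℤ) : ℝ) := by
            exact_mod_cast hs.le.trans (le_max_right _ _)
          positivity
    _ ≤ (7 * ((|e.2.2| : ℤ) : ℝ)) * (256 / ((|e.2.2| : ℤ) : ℝ)) := by
        simp_rw [← Finset.mul_sum]
        exact mul_le_mul_of_nonneg_left (sum_max_two _ hs N) (by positivity)
    _ = 1792 := by field_simp; norm_num

lemma sum_inv (N : ℕ) :
    ∑ z ∈ Finset.Icc (-(N : ℤ)) N, 1 / ((|z| : ℤ) : ℝ) ≤ 2 * (1 + Real.log N) := by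
  refine (sum_sym_le (fun y => 1 / ((y : ℤ) : ℝ)) (by simp) N).trans ?_
  have h := harmonic_le_one_add_log N
  rw [Finset.sum_range_succ']
  simp only [harmonic] at h
  push_cast at h ⊢
  simp only [one_div, inv_zero, add_zero]
  linarith

noncomputable def Ez (N : ℤ) : Finset Z3 := (bx N).filter (fun e => e.2.2 ≠ 0 ∧ |e.1| ≤ |e.2.2| ∧
    |e.2.1| ≤ |e.2.2|)

lemma outer_sum (N : ℕ) :
    ∑ e ∈ Ez N, 1 / ((|e.2.2| : ℤ) : ℝ) ^ 3 ≤ 18 * (1 + Real.log N) := by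
  have hmaps : ∀ e ∈ Ez N, e.2.2 ∈ Finset.Icc (-(N : ℤ)) N := by
    intro e he
    simp only [Ez, Finset.mem_filter, mem_bx] at he
    rw [Finset.mem_Icc]
    exact abs_le.1 he.1.2.2
  rw [← Finset.sum_fiberwise_of_maps_to hmaps]
  calc _ ≤ ∑ z ∈ Finset.Icc (-(N : ℤ)) N, 9 * (1 / ((|z| : ℤ) : ℝ)) := by
        refine Finset.sum_le_sum fun z _ => ?_
        have : ∀ e ∈ (Ez N).filter (fun e => e.2.2 = z), 1 / ((|e.2.2| : ℤ) : ℝ) ^ 3 =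
            1 / ((|z| : ℤ) : ℝ) ^ 3 := by
          intro e he; rw [(Finset.mem_filter.1 he).2]
        rw [Finset.sum_congr rfl this, Finset.sum_const, nsmul_eq_mul]
        by_cases hz : z = 0
        · have : (Ez N).filter (fun e => e.2.2 = z) = ∅ := by
            ext e; simp [Ez, hz]; tauto
          rw [this]; simp [hz]
        · have hs : 1 ≤ |z| := Int.one_le_abs hz
          have hcard : ((Ez N).filter (fun e => e.2.2 = z)).card ≤
              (Finset.Icc (-|z|) |z| ×ˢ Finset.Icc (-|z|) |z|).card := by
            apply Finset.card_le_card_of_injOn (fun e => (e.1, e.2.1))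
            · intro e he
              simp [Ez] at he
              obtain ⟨⟨_, _, h1, h2⟩, rfl⟩ := he
              simp [abs_le.1 h1, abs_le.1 h2]
            · rintro ⟨a, b, c⟩ he ⟨a', b', c'⟩ he' hh
              simp at he he' hh
              simp [hh, he.2, he'.2]
          rw [Finset.card_product, Int.card_Icc] at hcard
          have h2 : (((Ez N).filter (fun e => e.2.2 = z)).card : ℤ) ≤ 9 * |z| ^ 2 := by
            have h3 : ((|z| + 1 - -|z|).toNat : ℤ) ≤ 3 * |z| := by omega
            have h4 : (((Ez N).filter (fun e => e.2.2 = z)).card : ℤ) ≤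
              ((|z| + 1 - -|z|).toNat : ℤ) * ((|z| + 1 - -|z|).toNat : ℤ) := by exact_mod_cast hcard
            nlinarith
          have h2' : (((Ez N).filter (fun e => e.2.2 = z)).card : ℝ) ≤ 9 * ((|z| : ℤ) : ℝ) ^ 2 := by
            exact_mod_cast h2
          have hs' : (0 : ℝ) < ((|z| : ℤ) : ℝ) := by exact_mod_cast hs
          generalize ((|z| : ℤ) : ℝ) = s at *
          calc _ ≤ (9 * s ^ 2) * (1 / s ^ 3) := mul_le_mul_of_nonneg_right h2' (by positivity)
            _ = _ := by field_simp
    _ ≤ _ := by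
        rw [← Finset.mul_sum]; linarith [sum_inv N]

lemma sum_E (m : ℕ) :
    ∑ t ∈ E m, (1 / ((|t.1.2.2| : ℤ) : ℝ) ^ 3 * (1 / (tt t.1 t.2 : ℝ) ^ 3)) ≤
      1792 * (18 * (1 + Real.log (2 * m : ℕ))) := by
  have hN : (2 * (m : ℤ)) = ((2 * m : ℕ) : ℤ) := by push_cast; ring
  have : ∑ t ∈ E m, (1 / ((|t.1.2.2| : ℤ) : ℝ) ^ 3 * (1 / (tt t.1 t.2 : ℝ) ^ 3)) =
      ∑ e ∈ Ez (2 * m : ℕ), ∑ f ∈ (bx (2 * m : ℕ)).filter (fun f => |2 * dot e f| ≤ dot e e),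
        (1 / ((|e.2.2| : ℤ) : ℝ) ^ 3 * (1 / (tt e f : ℝ) ^ 3)) := by
    rw [Finset.sum_sigma']
    refine Finset.sum_bij' (fun t _ => ⟨t.1, t.2⟩) (fun t _ => (t.1, t.2)) ?_ ?_ ?_ ?_ ?_
    · intro t ht
      simp only [E, hN, Finset.mem_filter, Finset.mem_product] at ht
      simp only [Ez, Finset.mem_sigma, Finset.mem_filter]
      tauto
    · intro t ht
      simp only [Ez, Finset.mem_sigma, Finset.mem_filter] at ht
      simp only [E, hN, Finset.mem_filter, Finset.mem_product]
      tauto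
    · intros; rfl
    · intros; rfl
    · intros; rfl
  rw [this]
  calc _ ≤ ∑ e ∈ Ez (2 * m : ℕ), 1792 * (1 / ((|e.2.2| : ℤ) : ℝ) ^ 3) := by
        refine Finset.sum_le_sum fun e he => ?_
        rw [← Finset.mul_sum, mul_comm]
        simp only [Ez, Finset.mem_filter] at he
        have h := abs_nonneg e.2.2
        have h' : (0 : ℝ) ≤ ((|e.2.2| : ℤ) : ℝ) := by exact_mod_cast h
        exact mul_le_mul_of_nonneg_right (inner_sum _ e he.2.1 he.2.2.1 he.2.2.2) (by positivity)
    _ ≤ _ := by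
        rw [← Finset.mul_sum]
        exact mul_le_mul_of_nonneg_left (outer_sum _) (by norm_num)

theorem card_T (m : ℕ) (hm : 1 ≤ m) :
    ((T m).card : ℝ) ≤ 10 ^ 11 * (m : ℝ) ^ 6 * (1 + Real.log (2 * m : ℕ)) := by
  have hm' : (1 : ℤ) ≤ m := by exact_mod_cast hm
  have h1 : ((T m).card : ℝ) ≤ 3 * ((Tz m).card : ℝ) := by exact_mod_cast card_T_le hm'
  have h2 := card_Tz_le hm'
  have h3 := mul_le_mul_of_nonneg_left (sum_E m)
    (by positivity : 0 ≤ 64 ^ 3 * (((m : ℤ) : ℝ)) ^ 6)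
  have hl : 0 ≤ Real.log (2 * m : ℕ) := Real.log_natCast_nonneg _
  have h4 : 0 ≤ (m : ℝ) ^ 6 * (1 + Real.log (2 * m : ℕ)) := by positivity
  push_cast at *
  nlinarith

abbrev Bm (m : ℕ) := Fin m × Fin m × Fin m

def toZ {m : ℕ} (x : Bm m) : Z3 := (((x.1 : ℕ) : ℤ), ((x.2.1 : ℕ) : ℤ), ((x.2.2 : ℕ) : ℤ))

lemma toZ_inj {m : ℕ} {x y : Bm m} (h : toZ x = toZ y) : x = y := by
  obtain ⟨a, b, c⟩ := x
  obtain ⟨a', b', c'⟩ := y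
  simp only [toZ, Prod.mk.injEq] at h ⊢
  refine ⟨?_, ?_, ?_⟩ <;> ext <;> omega

lemma sub_mem_bx {m : ℕ} (x y : Bm m) : toZ x - toZ y ∈ bx m := by
  obtain ⟨a, b, c⟩ := x
  obtain ⟨a', b', c'⟩ := y
  simp only [mem_bx, toZ, Prod.mk_sub_mk, abs_le]
  omega

def Q (m : ℕ) : Finset (Bm m × Bm m × Bm m × Bm m) :=
  Finset.univ.filter fun t => dt (toZ t.2.1 - toZ t.1) (toZ t.2.2.1 - toZ t.1) (toZ t.2.2.2 - toZ t.1) = 0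

lemma card_Q (m : ℕ) : (Q m).card ≤ m ^ 3 * (T m).card := by
  have h : (Q m).card ≤ ((Finset.univ : Finset (Bm m)) ×ˢ T m).card := by
    apply Finset.card_le_card_of_injOn
      (fun t => (t.1, (toZ t.2.1 - toZ t.1, toZ t.2.2.1 - toZ t.1, toZ t.2.2.2 - toZ t.1)))
    · intro t ht
      have ht := (Finset.mem_filter.1 ht).2
      simp only [Finset.coe_product, Set.mem_prod, Finset.mem_coe, T, Finset.mem_univ, true_and,
        Finset.mem_filter, Finset.mem_product]
      exact ⟨⟨sub_mem_bx _ _, sub_mem_bx _ _, sub_mem_bx _ _⟩, ht⟩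
    · rintro ⟨a, b, c, d⟩ _ ⟨a', b', c', d'⟩ _ h
      simp only [Prod.mk.injEq] at h
      obtain ⟨rfl, h1, h2, h3⟩ := h
      simp only [Prod.mk.injEq, true_and]
      exact ⟨toZ_inj (sub_left_injective h1), toZ_inj (sub_left_injective h2),
        toZ_inj (sub_left_injective h3)⟩
  rw [Finset.card_product] at h
  have : (Finset.univ : Finset (Bm m)).card = m ^ 3 := by
    simp [Fintype.card_prod]; ring
  rwa [this] at h

def Dist4 {α : Type*} (t : α × α × α × α) : Prop :=
  t.1 ≠ t.2.1 ∧ t.1 ≠ t.2.2.1 ∧ t.1 ≠ t.2.2.2 ∧ t.2.1 ≠ t.2.2.1 ∧ t.2.1 ≠ t.2.2.2 ∧ t.2.2.1 ≠ t.2.2.2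

open Classical in
lemma exists_good {α β : Type*} [Fintype α] [Fintype β]
    (S : Finset (α × α × α × α)) (hS : ∀ t ∈ S, Dist4 t) (R : Finset (β × β × β × β))
    (h : S.card * R.card < Fintype.card β ^ 4) :
    ∃ ψ : α → β, ∀ t ∈ S, (ψ t.1, ψ t.2.1, ψ t.2.2.1, ψ t.2.2.2) ∉ R := by
  by_contra hcon
  push Not at hcon
  have hpos : 0 < Fintype.card β := by
    rcases Nat.eq_zero_or_pos (Fintype.card β) with h0 | h0
    · rw [h0] at h; simp at h
    · exact h0
  have key : ∀ t ∈ S, ((Finset.univ : Finset (α → β)).filter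
      (fun ψ => (ψ t.1, ψ t.2.1, ψ t.2.2.1, ψ t.2.2.2) ∈ R)).card ≤
      R.card * Fintype.card β ^ (Fintype.card α - 4) ∧ 4 ≤ Fintype.card α := by
    rintro ⟨a, b, c, d⟩ ht
    obtain ⟨h1, h2, h3, h4, h5, h6⟩ := hS _ ht
    simp only at h1 h2 h3 h4 h5 h6
    have hc4 : ({a, b, c, d} : Finset α).card = 4 := by
      rw [Finset.card_insert_of_notMem, Finset.card_insert_of_notMem,
        Finset.card_insert_of_notMem, Finset.card_singleton]
      · simpa using h6
      · simp [h4, h5]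
      · simp [h1, h2, h3]
    have hc : Fintype.card {x // x ∉ ({a, b, c, d} : Finset α)} = Fintype.card α - 4 := by
      rw [Fintype.card_subtype_compl, Fintype.card_coe, hc4]
    refine ⟨?_, hc4 ▸ Finset.card_le_univ _⟩
    have : R.card * Fintype.card β ^ (Fintype.card α - 4) =
        (R ×ˢ (Finset.univ : Finset ({x // x ∉ ({a, b, c, d} : Finset α)} → β))).card := by
      rw [Finset.card_product, Finset.card_univ, Fintype.card_fun, hc]
    rw [this]
    apply Finset.card_le_card_of_injOn (fun ψ => ((ψ a, ψ b, ψ c, ψ d), fun x => ψ x.1))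
    · intro ψ hψ
      have hψ := (Finset.mem_filter.1 hψ).2
      simpa using hψ
    · intro ψ _ ψ' _ hh
      simp only [Prod.mk.injEq] at hh
      obtain ⟨⟨ha, hb, hc, hd⟩, hr⟩ := hh
      funext x
      by_cases hx : x ∈ ({a, b, c, d} : Finset α)
      · simp only [Finset.mem_insert, Finset.mem_singleton] at hx
        rcases hx with rfl | rfl | rfl | rfl <;> assumption
      · exact congrFun hr ⟨x, hx⟩
  have hcov : (Finset.univ : Finset (α → β)) ⊆ S.biUnion fun t => Finset.univ.filter
      (fun ψ => (ψ t.1, ψ t.2.1, ψ t.2.2.1, ψ t.2.2.2) ∈ R) := by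
    intro ψ _
    obtain ⟨t, ht, hm⟩ := hcon ψ
    simp only [Finset.mem_biUnion, Finset.mem_filter]
    exact ⟨t, ht, Finset.mem_univ _, hm⟩
  have h1 := (Finset.card_le_card hcov).trans
    (Finset.card_biUnion_le_card_mul _ _ _ fun t ht => (key t ht).1)
  rw [Finset.card_univ, Fintype.card_fun] at h1
  have h4 : 4 ≤ Fintype.card α := by
    by_contra h4
    have : S = ∅ := by
      rw [Finset.eq_empty_iff_forall_notMem]
      exact fun t ht => h4 (key t ht).2
    rw [this] at h1
    simp at h1
    omega
  have h2 : Fintype.card β ^ Fintype.card α =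
      Fintype.card β ^ 4 * Fintype.card β ^ (Fintype.card α - 4) := by
    rw [← pow_add]; congr 1; omega
  rw [h2, ← mul_assoc] at h1
  have := Nat.mul_lt_mul_of_pos_right h (Nat.pow_pos (n := Fintype.card α - 4) hpos)
  omega

lemma card_line {m : ℕ} (A D : Z3) (hD : D ≠ 0) :
    ((Finset.univ : Finset (Bm m)).filter (fun x => crs (toZ x - A) D = 0)).card ≤ m := by
  have hm : (Finset.univ : Finset (Fin m)).card = m := by simp
  obtain ⟨A1, A2, A3⟩ := A
  obtain ⟨D1, D2, D3⟩ := D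
  by_cases h1 : D1 = 0
  · by_cases h2 : D2 = 0
    · have h3 : D3 ≠ 0 := by rintro rfl; exact hD (by simp [h1, h2])
      refine le_trans (Finset.card_le_card_of_injOn (t := (Finset.univ : Finset (Fin m)))
        (fun x => x.2.2) (by simp) ?_) hm.le
      rintro ⟨x, y, z⟩ hx ⟨x', y', z'⟩ hx' hh
      simp only at hh
      subst hh
      simp [crs, toZ, h1, h2, h3] at hx hx'
      simp only [Prod.mk.injEq, and_true]
      constructor <;> ext <;> omega
    · refine le_trans (Finset.card_le_card_of_injOn (t := (Finset.univ : Finset (Fin m)))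
        (fun x => x.2.1) (by simp) ?_) hm.le
      rintro ⟨x, y, z⟩ hx ⟨x', y', z'⟩ hx' hh
      simp only at hh
      subst hh
      simp [crs, toZ, h1, h2] at hx hx'
      have hz : ((z : ℕ) : ℤ) = (z' : ℕ) := by
        apply mul_right_cancel₀ h2
        linarith [hx.1, hx'.1]
      simp only [Prod.mk.injEq, true_and]
      constructor <;> ext <;> omega
  · refine le_trans (Finset.card_le_card_of_injOn (t := (Finset.univ : Finset (Fin m)))
        (fun x => x.1) (by simp) ?_) hm.le
    rintro ⟨x, y, z⟩ hx ⟨x', y', z'⟩ hx' hh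
    simp only at hh
    subst hh
    simp [crs, toZ] at hx hx'
    have hz : ((z : ℕ) : ℤ) = (z' : ℕ) := by
      apply mul_right_cancel₀ h1
      linarith [hx.2.1, hx'.2.1]
    have hy : ((y : ℕ) : ℤ) = (y' : ℕ) := by
      apply mul_right_cancel₀ h1
      linarith [hx.2.2, hx'.2.2]
    simp only [Prod.mk.injEq, true_and]
    constructor <;> ext <;> omega

def toF (p : Z3) : Fin 3 → ℤ := ![p.1, p.2.1, p.2.2]

def toR (p : Z3) : Fin 3 → ℝ := fun i => ((toF p i : ℤ) : ℝ)

lemma mem_seg {x : Fin 3 → ℝ} {u v : Z3} (h : x ∈ openSegment ℝ (toR u) (toR v)) :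
    ∃ b : ℝ, 0 < b ∧ b < 1 ∧ x 0 = u.1 + b * (v.1 - u.1) ∧ x 1 = u.2.1 + b * (v.2.1 - u.2.1) ∧
      x 2 = u.2.2 + b * (v.2.2 - u.2.2) := by
  obtain ⟨a, b, ha, hb, hab, rfl⟩ := h
  obtain rfl : a = 1 - b := by linarith
  refine ⟨b, hb, by linarith, ?_, ?_, ?_⟩ <;> simp [toR, toF] <;> ring

lemma seg_vertex {u v w : Z3} (h : toR w ∈ openSegment ℝ (toR u) (toR v)) :
    crs (w - u) (v - u) = 0 := by
  obtain ⟨b, -, -, h1, h2, h3⟩ := mem_seg h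
  obtain ⟨u1, u2, u3⟩ := u
  obtain ⟨v1, v2, v3⟩ := v
  obtain ⟨w1, w2, w3⟩ := w
  simp [toR, toF] at h1 h2 h3
  simp only [crs, Prod.mk_sub_mk, Prod.mk_eq_zero]
  rify
  refine ⟨?_, ?_, ?_⟩
  · linear_combination (v3 - u3 : ℝ) * h2 - (v2 - u2 : ℝ) * h3
  · linear_combination (v1 - u1 : ℝ) * h3 - (v3 - u3 : ℝ) * h1
  · linear_combination (v2 - u2 : ℝ) * h1 - (v1 - u1 : ℝ) * h2

lemma seg_adj {u v w : Z3} (h : crs (w - u) (v - u) ≠ 0) :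
    openSegment ℝ (toR u) (toR v) ∩ openSegment ℝ (toR u) (toR w) = ∅ := by
  rw [Set.eq_empty_iff_forall_notMem]
  rintro x ⟨hx, hx'⟩
  apply h
  obtain ⟨b, hb, -, h1, h2, h3⟩ := mem_seg hx
  obtain ⟨c, hc, -, k1, k2, k3⟩ := mem_seg hx'
  rw [h1] at k1
  rw [h2] at k2
  rw [h3] at k3
  obtain ⟨u1, u2, u3⟩ := u
  obtain ⟨v1, v2, v3⟩ := v
  obtain ⟨w1, w2, w3⟩ := w
  simp only [crs, Prod.mk_sub_mk, Prod.mk_eq_zero]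
  rify
  simp only at k1 k2 k3
  refine ⟨?_, ?_, ?_⟩ <;> apply mul_left_cancel₀ hc.ne' <;> rw [mul_zero]
  · linear_combination -(v3 - u3 : ℝ) * k2 + (v2 - u2 : ℝ) * k3
  · linear_combination -(v1 - u1 : ℝ) * k3 + (v3 - u3 : ℝ) * k1
  · linear_combination -(v2 - u2 : ℝ) * k1 + (v1 - u1 : ℝ) * k2

lemma seg_disj {u v w z : Z3} (h : dt (v - u) (w - u) (z - u) ≠ 0) :
    openSegment ℝ (toR u) (toR v) ∩ openSegment ℝ (toR w) (toR z) = ∅ := by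
  rw [Set.eq_empty_iff_forall_notMem]
  rintro x ⟨hx, hx'⟩
  apply h
  obtain ⟨b, hb, -, h1, h2, h3⟩ := mem_seg hx
  obtain ⟨c, hc, -, k1, k2, k3⟩ := mem_seg hx'
  rw [h1] at k1
  rw [h2] at k2
  rw [h3] at k3
  obtain ⟨u1, u2, u3⟩ := u
  obtain ⟨v1, v2, v3⟩ := v
  obtain ⟨w1, w2, w3⟩ := w
  obtain ⟨z1, z2, z3⟩ := z
  simp only [dt, dot, crs, Prod.mk_sub_mk]
  rify
  simp only at k1 k2 k3
  apply mul_left_cancel₀ hb.ne'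
  rw [mul_zero]
  linear_combination ((w2-u2)*(z3-u3) - (w3-u3)*(z2-u2) : ℝ) * k1 +
    ((w3-u3)*(z1-u1) - (w1-u1)*(z3-u3) : ℝ) * k2 + ((w1-u1)*(z2-u2) - (w2-u2)*(z1-u1) : ℝ) * k3

lemma two_edges {V : Type*} {a b c d : V} (h : s(a, b) ≠ s(c, d)) (hab : a ≠ b) (hcd : c ≠ d) :
    Dist4 (a, b, c, d) ∨ (a = c ∧ b ≠ d) ∨ (a = d ∧ b ≠ c) ∨ (b = c ∧ a ≠ d) ∨ (b = d ∧ a ≠ c) := by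
  simp only [ne_eq, Sym2.eq_iff, Dist4] at *
  tauto

lemma crs_swap (x y : Z3) (h : crs x y = 0) : crs y x = 0 := by
  simp only [crs, Prod.mk_eq_zero] at *
  obtain ⟨h1, h2, h3⟩ := h
  refine ⟨by linarith, by linarith, by linarith⟩

open Classical in
lemma exists_psi {n k m : ℕ} (G : SimpleGraph (Fin n)) (hk : Nat.card G.edgeSet = k)
    (h : (4 * k ^ 2) * (Q m).card < (m ^ 3) ^ 4) :
    ∃ p : Fin n → Bm m,
      (∀ a b c d, G.Adj a b → G.Adj c d → Dist4 (a, b, c, d) →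
        dt (toZ (p b) - toZ (p a)) (toZ (p c) - toZ (p a)) (toZ (p d) - toZ (p a)) ≠ 0) ∧
      (∀ a b c, G.Adj a b → G.Adj a c → b ≠ c →
        crs (toZ (p b) - toZ (p a)) (toZ (p c) - toZ (p a)) ≠ 0) := by
  let g : G.Dart × G.Dart → Option (Fin n) × Option (Fin n) × Option (Fin n) × Option (Fin n) :=
    fun t => if t.1.fst = t.2.fst then (some t.1.fst, some t.1.snd, some t.2.snd, none)
      else (some t.1.fst, some t.1.snd, some t.2.fst, some t.2.snd)
  let S := ((Finset.univ : Finset (G.Dart × G.Dart)).image g).filter Dist4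
  have hcard : S.card ≤ 4 * k ^ 2 := by
    refine (Finset.card_filter_le _ _).trans (Finset.card_image_le.trans ?_)
    rw [Finset.card_univ, Fintype.card_prod, G.dart_card_eq_twice_card_edges]
    have : G.edgeFinset.card = k := by
      rw [← hk, Nat.card_eq_fintype_card, SimpleGraph.edgeFinset_card]
    rw [this]
    apply le_of_eq; ring
  have hB : Fintype.card (Bm m) = m ^ 3 := by simp [Fintype.card_prod]; ring
  obtain ⟨ψ, hψ⟩ := exists_good S (fun t ht => (Finset.mem_filter.1 ht).2) (Q m) (by
    rw [hB]; exact lt_of_le_of_lt (Nat.mul_le_mul_right _ hcard) h)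
  have hQ : ∀ t ∈ S, dt (toZ (ψ t.2.1) - toZ (ψ t.1)) (toZ (ψ t.2.2.1) - toZ (ψ t.1))
      (toZ (ψ t.2.2.2) - toZ (ψ t.1)) ≠ 0 := by
    intro t ht h0
    exact hψ t ht (Finset.mem_filter.2 ⟨Finset.mem_univ _, h0⟩)
  refine ⟨fun v => ψ (some v), ?_, ?_⟩
  · intro a b c d hab hcd hd
    refine hQ (some a, some b, some c, some d) (Finset.mem_filter.2 ⟨Finset.mem_image.2
      ⟨(⟨(a, b), hab⟩, ⟨(c, d), hcd⟩), Finset.mem_univ _, ?_⟩, ?_⟩)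
    · have : a ≠ c := hd.2.1
      simp [g, this]
    · simpa [Dist4] using hd
  · intro a b c hab hac hbc h0
    refine hQ (some a, some b, some c, none) (Finset.mem_filter.2 ⟨Finset.mem_image.2
      ⟨(⟨(a, b), hab⟩, ⟨(a, c), hac⟩), Finset.mem_univ _, ?_⟩, ?_⟩) ?_
    · simp [g]
    · simpa [Dist4, hbc] using ⟨hab.ne, hac.ne⟩
    · simp only [dt]
      rw [h0]; simp [dot]

open Classical in
theorem drawing {n k m : ℕ} (G : SimpleGraph (Fin n)) (hk : Nat.card G.edgeSet = k) (hk2 : 2 ≤ k)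
    (h : (4 * k ^ 2) * (Q m).card < (m ^ 3) ^ 4) (h' : n + 2 * k * m ≤ m ^ 3) :
    ∃ φ : Fin n → (Fin 3 → ℤ), IsGridDrawing m G φ := by
  obtain ⟨p, hp1, hp2⟩ := exists_psi G hk h
  have hkc : G.edgeFinset.card = k := by
    rw [← hk, Nat.card_eq_fintype_card, SimpleGraph.edgeFinset_card]
  -- another edge
  have hother : ∀ u v, G.Adj u v → ∃ z x, G.Adj z x ∧ z ≠ u ∧ z ≠ v := by
    intro u v huv
    obtain ⟨e, he, hne⟩ := Finset.exists_mem_ne (by omega : 1 < G.edgeFinset.card) s(u, v)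
    induction e using Sym2.ind with
    | _ c d =>
      have hcd : G.Adj c d := by simpa using he
      by_cases hc : c ≠ u ∧ c ≠ v
      · exact ⟨c, d, hcd, hc.1, hc.2⟩
      · refine ⟨d, c, hcd.symm, ?_, ?_⟩
        · rintro rfl
          have := hcd.ne
          apply hne
          rw [Sym2.eq_iff]; tauto
        · rintro rfl
          have := hcd.ne
          apply hne
          rw [Sym2.eq_iff]; tauto
  have hp3 : ∀ u v w x, G.Adj u v → G.Adj w x → w ≠ u → w ≠ v →
      crs (toZ (p w) - toZ (p u)) (toZ (p v) - toZ (p u)) ≠ 0 := by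
    intro u v w x huv hwx hwu hwv h0
    by_cases hxu : x = u
    · subst hxu
      exact hp2 x w v hwx.symm huv hwv h0
    by_cases hxv : x = v
    · subst hxv
      refine hp2 x w u hwx.symm huv.symm hwu ?_
      generalize toZ (p w) = W at *
      generalize toZ (p u) = U at *
      generalize toZ (p x) = X at *
      obtain ⟨u1, u2, u3⟩ := U
      obtain ⟨v1, v2, v3⟩ := X
      obtain ⟨w1, w2, w3⟩ := W
      simp only [crs, Prod.mk_sub_mk, Prod.mk_eq_zero] at h0 ⊢
      obtain ⟨h1, h2, h3⟩ := h0
      refine ⟨by linarith, by linarith, by linarith⟩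
    · refine hp1 u v w x huv hwx ⟨huv.ne, hwu.symm, Ne.symm hxu, hwv.symm, Ne.symm hxv, hwx.ne⟩ ?_
      simp only [dt]
      rw [crs_swap _ _ h0]; simp [dot]
  have hp0 : ∀ u v, G.Adj u v → toZ (p v) - toZ (p u) ≠ 0 := by
    intro u v huv h0
    obtain ⟨z, x, hzx, h1, h2⟩ := hother u v huv
    apply hp3 u v z x huv hzx h1 h2
    rw [h0]; simp [crs]
  -- free points
  let bad : Finset (Bm m) := (Finset.univ : Finset G.Dart).biUnion fun d =>
    Finset.univ.filter (fun x => crs (toZ x - toZ (p d.fst)) (toZ (p d.snd) - toZ (p d.fst)) = 0)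
  have hbad : bad.card ≤ 2 * k * m := by
    refine (Finset.card_biUnion_le_card_mul _ _ m ?_).trans (le_of_eq ?_)
    · intro d _
      exact card_line _ _ (hp0 _ _ d.adj)
    · rw [Finset.card_univ, G.dart_card_eq_twice_card_edges, hkc]
  have hB : Fintype.card (Bm m) = m ^ 3 := by simp [Fintype.card_prod]; ring
  have hfree : Fintype.card (Fin n) ≤ Fintype.card {x // x ∈ badᶜ} := by
    rw [Fintype.card_fin, Fintype.card_coe, Finset.card_compl, hB]
    omega
  obtain ⟨ι⟩ := Function.Embedding.nonempty_of_card_le hfree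
  let q : Fin n → Bm m := fun v => if ∃ x, G.Adj v x then p v else (ι v).1
  have hq1 : ∀ v x, G.Adj v x → q v = p v := fun v x hx => by
    simp only [q]; rw [if_pos ⟨x, hx⟩]
  have hA : ∀ u v w, G.Adj u v → w ≠ u → w ≠ v →
      crs (toZ (q w) - toZ (q u)) (toZ (q v) - toZ (q u)) ≠ 0 := by
    intro u v w huv hwu hwv
    rw [hq1 u v huv, hq1 v u huv.symm]
    by_cases hw : ∃ x, G.Adj w x
    · obtain ⟨x, hx⟩ := hw
      rw [hq1 w x hx]
      exact hp3 u v w x huv hx hwu hwv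
    · have : q w = (ι w).1 := by simp only [q]; rw [if_neg hw]
      rw [this]
      intro h0
      have hm := (ι w).2
      rw [Finset.mem_compl] at hm
      apply hm
      exact Finset.mem_biUnion.2 ⟨⟨(u, v), huv⟩, Finset.mem_univ _,
        Finset.mem_filter.2 ⟨Finset.mem_univ _, h0⟩⟩
  have hadj : ∀ u v, G.Adj u v → q u ≠ q v := by
    intro u v huv h0
    apply hp0 u v huv
    rw [← hq1 u v huv, ← hq1 v u huv.symm, h0, sub_self]
  have hne : ∀ w w', w ≠ w' → (∃ x, G.Adj w x) → q w ≠ q w' := by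
    rintro w w' hww ⟨x, hx⟩ h0
    by_cases hxw : w' = x
    · subst hxw; exact hadj _ _ hx h0
    · apply hA w x w' hx hww.symm hxw
      rw [h0, sub_self]; simp [crs]
  have hinj : Function.Injective q := by
    intro w w' h0
    by_contra hww
    by_cases hw : ∃ x, G.Adj w x
    · exact hne w w' hww hw h0
    by_cases hw' : ∃ x, G.Adj w' x
    · exact hne w' w (Ne.symm hww) hw' h0.symm
    · simp only [q] at h0
      rw [if_neg hw, if_neg hw'] at h0
      exact hww (ι.injective (Subtype.ext h0))
  refine ⟨fun v => toF (toZ (q v)), ?_, ?_, ?_, ?_⟩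
  · intro v w hvw
    apply hinj
    apply toZ_inj
    have h0 := congrFun hvw 0
    have h1 := congrFun hvw 1
    have h2 := congrFun hvw 2
    simp only [toF] at h0 h1 h2
    exact Prod.ext h0 (Prod.ext h1 h2)
  · intro v i
    fin_cases i <;> simp [toF, toZ]
  · intro u v w huv hwu hwv hmem
    exact hA u v w huv hwu hwv (seg_vertex hmem)
  · intro u v u' v' huv huv' hne
    change openSegment ℝ (toR (toZ (q u))) (toR (toZ (q v))) ∩
      openSegment ℝ (toR (toZ (q u'))) (toR (toZ (q v'))) = ∅
    rcases two_edges hne huv.ne huv'.ne with hd | ⟨rfl, h1⟩ | ⟨rfl, h1⟩ | ⟨rfl, h1⟩ | ⟨rfl, h1⟩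
    · apply seg_disj
      rw [hq1 u v huv, hq1 v u huv.symm, hq1 u' v' huv', hq1 v' u' huv'.symm]
      exact hp1 _ _ _ _ huv huv' hd
    · exact seg_adj (hA u v v' huv huv'.ne.symm h1.symm)
    · rw [openSegment_symm ℝ (toR (toZ (q u')))]
      exact seg_adj (hA u v u' huv huv'.ne h1.symm)
    · rw [openSegment_symm ℝ (toR (toZ (q u)))]
      exact seg_adj (hA v u v' huv.symm huv'.ne.symm h1.symm)
    · rw [openSegment_symm ℝ (toR (toZ (q u))), openSegment_symm ℝ (toR (toZ (q u')))]
      exact seg_adj (hA v u u' huv.symm huv'.ne h1.symm)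

lemma numeric1 (k m : ℕ) (hk : 2 ≤ k) (hC : (10 : ℝ) ^ 25 ≤ m)
    (h : 10 ^ 75 * ((k : ℝ) ^ 2 * Real.log k) ≤ (m : ℝ) ^ 3) :
    4 * 10 ^ 11 * (k : ℝ) ^ 2 * (1 + Real.log (2 * m : ℕ)) < (m : ℝ) ^ 3 := by
  have hm0 : (0 : ℝ) < m := by linarith [show (0 : ℝ) < 10 ^ 25 by norm_num]
  have hk' : (2 : ℝ) ≤ k := by exact_mod_cast hk
  have hlk : 0.69 ≤ Real.log k := by
    have := Real.log_two_gt_d9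
    have := Real.log_le_log (by norm_num) hk'
    linarith
  have hl2 : Real.log (2 * m : ℕ) ≤ 1 + Real.log m := by
    push_cast
    rw [Real.log_mul (by norm_num) hm0.ne']
    have := Real.log_two_lt_d9
    linarith
  rcases le_total (m : ℝ) k with hmk | hmk
  · have h1 := Real.log_le_log hm0 hmk
    have h2 : 1 + Real.log (2 * m : ℕ) ≤ 4 * Real.log k := by linarith
    have h3 := mul_le_mul_of_nonneg_left h2 (by positivity : 0 ≤ 4 * 10 ^ 11 * (k : ℝ) ^ 2)
    have h4 : 0 < (k : ℝ) ^ 2 * Real.log k := by positivity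
    nlinarith
  · have hs0 : 0 < Real.sqrt m := Real.sqrt_pos.2 hm0
    have hs : Real.sqrt m ^ 2 = m := Real.sq_sqrt hm0.le
    have hbig : 3 * 10 ^ 12 ≤ Real.sqrt m := by
      apply Real.le_sqrt_of_sq_le
      refine le_trans ?_ hC
      norm_num
    have hlog : Real.log m ≤ 2 * Real.sqrt m := by
      rw [← hs, Real.log_pow, hs]
      have := Real.log_le_sub_one_of_pos hs0
      push_cast
      linarith
    have h1 : 4 * 10 ^ 11 * (1 + Real.log (2 * m : ℕ)) < m := by
      nlinarith
    have h2 : (k : ℝ) ^ 2 ≤ (m : ℝ) ^ 2 := pow_le_pow_left₀ (by positivity) hmk 2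
    calc _ = (k : ℝ) ^ 2 * (4 * 10 ^ 11 * (1 + Real.log (2 * m : ℕ))) := by ring
      _ < (k : ℝ) ^ 2 * m := mul_lt_mul_of_pos_left h1 (by positivity)
      _ ≤ (m : ℝ) ^ 2 * m := mul_le_mul_of_nonneg_right h2 hm0.le
      _ = _ := by ring

lemma numeric2 (n k m : ℕ) (hk : 2 ≤ k) (h1 : 2 * n ≤ m ^ 3) (h2 : 64 * k ^ 2 ≤ m ^ 3) :
    n + 2 * k * m ≤ m ^ 3 := by
  have h3 : 4 * k ≤ m ^ 2 := by
    by_contra hcon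
    push Not at hcon
    have a1 : (m ^ 2) ^ 3 < (4 * k) ^ 3 := Nat.pow_lt_pow_left hcon (by norm_num)
    have a2 : (64 * k ^ 2) ^ 2 ≤ (m ^ 3) ^ 2 := Nat.pow_le_pow_left h2 2
    have a3 : (m ^ 2) ^ 3 = (m ^ 3) ^ 2 := by ring
    have a4 : (4 * k) ^ 3 ≤ (64 * k ^ 2) ^ 2 := by
      calc (4 * k) ^ 3 = 64 * k ^ 3 * 1 := by ring
        _ ≤ 64 * k ^ 3 * (64 * k) := Nat.mul_le_mul_left _ (by omega)
        _ = _ := by ring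
    omega
  have h4 := Nat.mul_le_mul_right m h3
  have h5 : m ^ 2 * m = m ^ 3 := by ring
  rw [h5] at h4
  nlinarith

end GD

theorem stmt16 :
    ∃ C : ℝ, 0 < C ∧ ∀ (n k m : ℕ) (G : SimpleGraph (Fin n)),
      Nat.card G.edgeSet = k → 2 ≤ k →
      C * (((n * k : ℕ) : ℝ) ^ ((1 : ℝ) / 3) +
        (k : ℝ) ^ ((2 : ℝ) / 3) * (Real.log k) ^ ((1 : ℝ) / 3)) ≤ (m : ℝ) →
      ∃ φ : Fin n → (Fin 3 → ℤ), IsGridDrawing m G φ := by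
  refine ⟨10 ^ 25, by norm_num, ?_⟩
  intro n k m G hk hk2 hm
  have hk' : (2 : ℝ) ≤ k := by exact_mod_cast hk2
  have hk0 : (0 : ℝ) ≤ k := by positivity
  have hlk : 0.69 ≤ Real.log k := by
    have := Real.log_two_gt_d9
    have := Real.log_le_log (by norm_num) hk'
    linarith
  obtain ⟨X, hX⟩ : ∃ X, X = ((n * k : ℕ) : ℝ) ^ ((1 : ℝ) / 3) := ⟨_, rfl⟩
  obtain ⟨Y, hY⟩ : ∃ Y, Y = (k : ℝ) ^ ((2 : ℝ) / 3) * (Real.log k) ^ ((1 : ℝ) / 3) := ⟨_, rfl⟩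
  have hX0 : 0 ≤ X := by rw [hX]; positivity
  have hY0 : 0 ≤ Y := by rw [hY]; positivity
  have hX3 : X ^ 3 = ((n * k : ℕ) : ℝ) := by
    rw [hX, ← Real.rpow_natCast, ← Real.rpow_mul (by positivity)]; norm_num
  have hY3 : Y ^ 3 = (k : ℝ) ^ 2 * Real.log k := by
    rw [hY, mul_pow, ← Real.rpow_natCast, ← Real.rpow_natCast, ← Real.rpow_mul hk0,
      ← Real.rpow_mul (by linarith)]
    norm_num
  rw [← hX, ← hY] at hm
  have hk4 : (4 : ℝ) ≤ (k : ℝ) ^ 2 := by nlinarith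
  have hmX : 10 ^ 75 * ((n * k : ℕ) : ℝ) ≤ (m : ℝ) ^ 3 := by
    have : (10 ^ 25 * X) ^ 3 ≤ (m : ℝ) ^ 3 := pow_le_pow_left₀ (by positivity) (by linarith) 3
    rw [mul_pow, hX3] at this
    linarith
  have hmY : 10 ^ 75 * ((k : ℝ) ^ 2 * Real.log k) ≤ (m : ℝ) ^ 3 := by
    have : (10 ^ 25 * Y) ^ 3 ≤ (m : ℝ) ^ 3 := pow_le_pow_left₀ (by positivity) (by linarith) 3
    rw [mul_pow, hY3] at this
    linarith
  have hY1 : 1 ≤ Y := by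
    by_contra hcon
    push Not at hcon
    have : Y ^ 3 < 1 := pow_lt_one₀ hY0 hcon (by norm_num)
    nlinarith
  have hC : (10 : ℝ) ^ 25 ≤ m := by nlinarith
  have hm1 : 1 ≤ m := by
    have : (1 : ℝ) ≤ m := by linarith [show (1 : ℝ) ≤ 10 ^ 25 by norm_num]
    exact_mod_cast this
  have hm0 : (0 : ℝ) < m := by exact_mod_cast hm1
  apply GD.drawing G hk hk2
  · have h1 := GD.card_T m hm1
    have h2 : ((GD.Q m).card : ℝ) ≤ (m : ℝ) ^ 3 * ((GD.T m).card : ℝ) := by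
      exact_mod_cast GD.card_Q m
    have h3 := GD.numeric1 k m hk2 hC hmY
    have : (4 * (k : ℝ) ^ 2) * ((GD.Q m).card : ℝ) < ((m : ℝ) ^ 3) ^ 4 := by
      calc _ ≤ (4 * (k : ℝ) ^ 2) * ((m : ℝ) ^ 3 *
            (10 ^ 11 * (m : ℝ) ^ 6 * (1 + Real.log (2 * m : ℕ)))) := by gcongr; exact h2.trans (by gcongr)
        _ = (m : ℝ) ^ 9 * (4 * 10 ^ 11 * (k : ℝ) ^ 2 * (1 + Real.log (2 * m : ℕ))) := by ring
        _ < (m : ℝ) ^ 9 * (m : ℝ) ^ 3 := mul_lt_mul_of_pos_left h3 (by positivity)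
        _ = _ := by ring
    exact_mod_cast this
  · apply GD.numeric2 n k m hk2
    · have h1 : (n : ℝ) ≤ ((n * k : ℕ) : ℝ) := by
        exact_mod_cast Nat.le_mul_of_pos_right n (by omega)
      have h0 : (0 : ℝ) ≤ n := by positivity
      have : 2 * (n : ℝ) ≤ (m : ℝ) ^ 3 := by linarith
      exact_mod_cast this
    · have : 64 * (k : ℝ) ^ 2 ≤ (m : ℝ) ^ 3 := by
        have : (k : ℝ) ^ 2 * 0.69 ≤ (k : ℝ) ^ 2 * Real.log k :=
          mul_le_mul_of_nonneg_left hlk (by positivity)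
        linarith
      exact_mod_cast this
end
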